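/- Constant-term identity: for positive integers k₁,…,k_d, one has ∑_{j=0}^d (-1)^{k₁+⋯+k_j} ζ^*(k_j,…,k₁) ζ^*(k_{j+1},…,k_d) + ∑_{j=1}^d ∑_{a+b=k_j, a,b≥0} (-1)^{k₁+⋯+k_{j-1}+a} ζ_a^*(k_{j-1},…,k₁) ζ_b^*(k_{j+1},…,k_d) = δ^{k₁,…,k_d} + ∑_{j=1}^d ∑_{a+2m+b=k_j, a,b≥0, m≥1} (-1)^{k₁+⋯+k_{j-1}+a} ζ_a^*(k_{j-1},…,k₁) ζ_b^*(k_{j+1},…,k_d) · 2ζ(2m). -/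

import Mathlib

open scoped BigOperators
open Real

/-- The multiple zeta value `ζ(k₁,…,k_d) = ∑_{0<m₁<⋯<m_d} ∏ 1/m_i^{k_i}`
(as a `tsum` over strictly increasing tuples of positive integers). -/
noncomputable def MZV (k : List ℕ) : ℝ :=
  ∑' m : {f : Fin k.length → ℕ+ // StrictMono f}, ∏ i, 1 / ((m.1 i : ℕ) : ℝ) ^ k.get i

/-- The stuffle (quasi-shuffle) product of two words, as a multiset of words. -/
def stuffle : List ℕ → List ℕ → Multiset (List ℕ)
  | [], v => {v}
  | u, [] => {u}
  | a :: u, b :: v =>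
      (stuffle u (b :: v)).map (a :: ·) + (stuffle (a :: u) v).map (b :: ·) +
        (stuffle u v).map ((a + b) :: ·)
  termination_by u v => u.length + v.length

/-- All contractions of a word: the results of replacing each comma by `,` or `+`. -/
def contractions : List ℕ → Multiset (List ℕ)
  | [] => {[]}
  | [a] => {[a]}
  | a :: b :: t => (contractions (b :: t)).map (a :: ·) + contractions ((a + b) :: t)
  termination_by l => l.length

/-- `Z` is a stuffle (harmonic) regularization of multiple zeta values:
it takes the value `1` on the empty word, agrees with the convergent multiple zeta
values on admissible words, and is a homomorphism for the stuffle product. -/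
structure IsStuffleReg (Z : List ℕ → ℝ) : Prop where
  empty : Z [] = 1
  conv : ∀ l : List ℕ, (∀ i ∈ l, 0 < i) → 2 ≤ l.getLastD 2 → Z l = MZV l
  mul : ∀ u v : List ℕ, (∀ i ∈ u, 0 < i) → (∀ i ∈ v, 0 < i) →
    Z u * Z v = ((stuffle u v).map Z).sum

/-- The star version `ζ^{⋆,*}(k₁,…,k_d)`: the sum of `Z` over all contractions. -/
noncomputable def zetaStarOf (Z : List ℕ → ℝ) (l : List ℕ) : ℝ :=
  ((contractions l).map Z).sum

/-- `ζ_a^*(l₁,…,l_r) = (-1)^a ∑_{a₁+⋯+a_r=a} ζ^*(l₁+a₁,…,l_r+a_r) ∏ C(l_i-1+a_i,a_i)`. -/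
noncomputable def zetaA (Z : List ℕ → ℝ) (a : ℕ) (l : List ℕ) : ℝ :=
  (-1 : ℝ) ^ a *
    ∑ f ∈ (Fintype.piFinset fun _ : Fin l.length => Finset.range (a + 1)).filter
        (fun f => ∑ i, f i = a),
      Z (List.ofFn fun i => l.get i + f i) *
        ∏ i, (Nat.choose (l.get i - 1 + f i) (f i) : ℝ)

/-- `δ^{k₁,…,k_d}`: equal to `(-1)^n π^{2n}/(2n)!` if `(k₁,…,k_d) = (1,…,1)` has even
length `2n`, and `0` otherwise. -/
noncomputable def deltaVal (l : List ℕ) : ℝ :=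
  if l.all (· = 1) ∧ l.length % 2 = 0 then
    (-1 : ℝ) ^ (l.length / 2) * π ^ l.length / (Nat.factorial l.length) else 0

section WordSeries

variable {R : Type*} [CommRing R]

/-- The concatenation product of two noncommutative series, viewed as functions on words. -/
def conv : (List ℕ → R) → (List ℕ → R) → List ℕ → R
  | f, g, [] => f [] * g []
  | f, g, b :: v => f [] * g (b :: v) + conv (fun w => f (b :: w)) g v

/-- The unit for the concatenation product. -/
def convOne : List ℕ → R
  | [] => 1
  | _ :: _ => 0

/-- The series `1 + ∑ x ^ k y_k`. -/
def geo (x : R) : List ℕ → R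
  | [] => 1
  | [k] => x ^ k
  | _ :: _ :: _ => 0

/-- The monomial quasisymmetric functions of a list of points, as a series. -/
def qs : List R → List ℕ → R
  | [] => convOne
  | x :: xs => conv (geo x) (qs xs)

@[simp] lemma conv_nil (f g : List ℕ → R) : conv f g [] = f [] * g [] := rfl

lemma conv_cons (f g : List ℕ → R) (b : ℕ) (v : List ℕ) :
    conv f g (b :: v) = f [] * g (b :: v) + conv (fun w => f (b :: w)) g v := rfl

lemma conv_eq_sum (f g : List ℕ → R) (w : List ℕ) :
    conv f g w = ∑ j ∈ Finset.range (w.length + 1), f (w.take j) * g (w.drop j) := by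
  induction w generalizing f with
  | nil => simp
  | cons b v ih =>
    rw [conv_cons, ih, List.length_cons, Finset.sum_range_succ' _ (v.length + 1)]
    simp [add_comm]

lemma conv_add_left (f f' g : List ℕ → R) (w : List ℕ) :
    conv (fun w => f w + f' w) g w = conv f g w + conv f' g w := by
  simp only [conv_eq_sum, add_mul, Finset.sum_add_distrib]

lemma conv_smul_left (c : R) (f g : List ℕ → R) (w : List ℕ) :
    conv (fun w => c * f w) g w = c * conv f g w := by
  simp only [conv_eq_sum, Finset.mul_sum, mul_assoc]

lemma conv_one_left (g : List ℕ → R) : conv convOne g = g := by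
  funext w
  cases w with
  | nil => simp [convOne]
  | cons b v =>
    have : conv (fun w => (convOne : List ℕ → R) (b :: w)) g v = 0 := by
      rw [conv_eq_sum]
      exact Finset.sum_eq_zero fun j _ => by simp [convOne]
    rw [conv_cons, this]
    simp [convOne]

lemma conv_one_right (f : List ℕ → R) : conv f convOne = f := by
  funext w
  induction w generalizing f with
  | nil => simp [convOne]
  | cons b v ih => simp [conv_cons, convOne, ih]

lemma conv_assoc (f g h : List ℕ → R) : conv (conv f g) h = conv f (conv g h) := by
  funext w
  induction w generalizing f with
  | nil => simp [mul_assoc]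
  | cons b v ih =>
    have := conv_add_left (fun w => f [] * g (b :: w)) (conv (fun w => f (b :: w)) g) h v
    simp only [conv_cons f g, conv_cons (conv f g), conv_cons f (conv g h), conv_cons g h, this,
      conv_smul_left, ih, conv_nil]
    ring

lemma conv_congr {f f' g g' : List ℕ → R} {w : List ℕ}
    (hf : ∀ j, f (w.take j) = f' (w.take j)) (hg : ∀ j, g (w.drop j) = g' (w.drop j)) :
    conv f g w = conv f' g' w := by
  simp only [conv_eq_sum, hf, hg]

lemma map_conv {S : Type*} [CommRing S] (φ : R →+* S) (f g : List ℕ → R) (w : List ℕ) :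
    φ (conv f g w) = conv (fun w => φ (f w)) (fun w => φ (g w)) w := by
  simp only [conv_eq_sum, map_sum, map_mul]

lemma conv_reverse (f g : List ℕ → R) (w : List ℕ) :
    conv f g w.reverse = conv (fun w => g w.reverse) (fun w => f w.reverse) w := by
  simp only [conv_eq_sum, List.length_reverse]
  rw [← Finset.sum_range_reflect]
  refine Finset.sum_congr rfl fun j hj => ?_
  have : j ≤ w.length := by simpa [Nat.lt_succ_iff] using hj
  rw [List.reverse_take, List.reverse_drop, mul_comm]
  congr 3

/-- The twist `f ↦ (w ↦ (-1)^{|w|} f(w reversed))`. -/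
def dagger (f : List ℕ → R) (w : List ℕ) : R := (-1) ^ w.sum * f w.reverse

lemma dagger_conv (f g : List ℕ → R) : dagger (conv f g) = conv (dagger g) (dagger f) := by
  funext w
  simp only [dagger, conv_reverse]
  simp only [conv_eq_sum, Finset.mul_sum]
  refine Finset.sum_congr rfl fun j _ => ?_
  simp only [dagger]
  rw [← List.sum_take_add_sum_drop w j, pow_add]
  ring

lemma dagger_geo (x : R) : dagger (geo x) = geo (-x) := by
  funext w
  match w with
  | [] => simp [dagger, geo]
  | [k] => simp [dagger, geo, ← mul_pow]
  | a :: b :: v =>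
    have : ∃ c d u, (a :: b :: v).reverse = c :: d :: u := by
      match h : (a :: b :: v).reverse with
      | [] => simp at h
      | [c] => have := congrArg List.length h; simp at this
      | c :: d :: u => exact ⟨c, d, u, rfl⟩
    obtain ⟨c, d, u, h⟩ := this
    simp only [dagger, h, geo, mul_zero]

lemma dagger_one : dagger (convOne : List ℕ → R) = convOne := by
  funext w
  match w with
  | [] => simp [dagger, convOne]
  | a :: v =>
    have : ∃ c u, (a :: v).reverse = c :: u := by
      match h : (a :: v).reverse with
      | [] => simp at h
      | c :: u => exact ⟨c, u, rfl⟩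
    obtain ⟨c, u, h⟩ := this
    simp only [dagger, h, convOne, mul_zero]

lemma qs_cons (x : R) (xs : List R) : qs (x :: xs) = conv (geo x) (qs xs) := rfl

lemma qs_singleton (x : R) : qs [x] = geo x := conv_one_right _

lemma qs_append (xs ys : List R) : qs (xs ++ ys) = conv (qs xs) (qs ys) := by
  induction xs with
  | nil => simp [qs, conv_one_left]
  | cons x xs ih => rw [List.cons_append, qs_cons, ih, qs_cons, conv_assoc]

@[simp] lemma qs_nil (xs : List R) : qs xs [] = 1 := by
  induction xs with
  | nil => rfl
  | cons x xs ih => simp [qs_cons, ih, geo]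

lemma dagger_qs (xs : List R) : dagger (qs xs) = qs (xs.reverse.map (-·)) := by
  induction xs with
  | nil => simp [qs, dagger_one]
  | cons x xs ih =>
    rw [qs_cons, dagger_conv, ih, dagger_geo, List.reverse_cons, List.map_append, qs_append,
      List.map_singleton, qs_singleton]

lemma map_geo {S : Type*} [CommRing S] (φ : R →+* S) (x : R) (w : List ℕ) :
    φ (geo x w) = geo (φ x) w := by
  match w with
  | [] => simp [geo]
  | [k] => simp [geo]
  | a :: b :: v => simp [geo]

lemma map_qs {S : Type*} [CommRing S] (φ : R →+* S) (xs : List R) (w : List ℕ) :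
    φ (qs xs w) = qs (xs.map φ) w := by
  induction xs generalizing w with
  | nil => cases w <;> simp [qs, convOne]
  | cons x xs ih => simp only [qs_cons, map_conv, map_geo, ih, List.map_cons]

lemma conv_geo_cons (x : R) (g : List ℕ → R) (b : ℕ) (v : List ℕ) :
    conv (geo x) g (b :: v) = g (b :: v) + x ^ b * g v := by
  have h : (fun w => geo x (b :: w)) = fun w => x ^ b * (convOne : List ℕ → R) w := by
    funext w
    cases w <;> simp [geo, convOne]
  rw [conv_cons, h, conv_smul_left, conv_one_left]
  simp [geo]

lemma qs_cons_cons (x : R) (xs : List R) (b : ℕ) (v : List ℕ) :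
    qs (x :: xs) (b :: v) = qs xs (b :: v) + x ^ b * qs xs v := by
  rw [qs_cons, conv_geo_cons]

lemma conv_geo_append (x : R) (f : List ℕ → R) (v : List ℕ) (b : ℕ) :
    conv f (geo x) (v ++ [b]) = f (v ++ [b]) + f v * x ^ b := by
  induction v generalizing f with
  | nil => simp [conv_cons, geo, add_comm]
  | cons a v ih =>
    rw [List.cons_append, conv_cons, ih]
    have : geo x (a :: (v ++ [b])) = 0 := by
      cases v <;> simp [geo]
    rw [this]
    simp

lemma qs_append_singleton (x : R) (xs : List R) (v : List ℕ) (b : ℕ) :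
    qs (xs ++ [x]) (v ++ [b]) = qs xs (v ++ [b]) + qs xs v * x ^ b := by
  rw [qs_append, qs_singleton, conv_geo_append]

lemma conv_geo_conv (x : R) (f g : List ℕ → R) (w : List ℕ) :
    conv f (conv (geo x) g) w =
      (∑ j ∈ Finset.range (w.length + 1), f (w.take j) * g (w.drop j)) +
        ∑ j ∈ Finset.range w.length, f (w.take j) * x ^ (w.getD j 0) * g (w.drop (j + 1)) := by
  rw [conv_eq_sum, Finset.sum_range_succ, Finset.sum_range_succ, add_right_comm,
    ← Finset.sum_add_distrib]
  congr 1
  · refine Finset.sum_congr rfl fun j hj => ?_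
    rw [Finset.mem_range] at hj
    rw [List.drop_eq_getElem_cons hj, conv_geo_cons, List.getD_eq_getElem _ _ hj]
    ring
  · simp [geo]

/-- A series in the single letter `1` with the given coefficients. -/
def ones (p : ℕ → R) (w : List ℕ) : R := if ∀ i ∈ w, i = 1 then p w.length else 0

lemma ones_cons_one (p : ℕ → R) (v : List ℕ) :
    ones p (1 :: v) = ones (fun n => p (n + 1)) v := by
  simp [ones]

lemma ones_cons_ne (p : ℕ → R) {b : ℕ} (hb : b ≠ 1) (v : List ℕ) : ones p (b :: v) = 0 := by
  simp [ones, hb]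

lemma conv_ones (p q : ℕ → R) : conv (ones p) (ones q) =
    ones fun n : ℕ => ∑ ij ∈ Finset.HasAntidiagonal.antidiagonal n, p ij.1 * q ij.2 := by
  funext w
  induction w generalizing p with
  | nil => simp [ones]
  | cons b v ih =>
    rw [conv_cons]
    by_cases hb : b = 1
    · subst hb
      simp only [ones_cons_one, ih, Finset.Nat.antidiagonal_succ, Finset.sum_cons]
      by_cases hv : ∀ i ∈ v, i = 1
      · simp only [ones, if_pos hv]
        simp
      · simp only [ones, if_neg hv]
        simp
    · simp only [ones_cons_ne _ hb]
      simp [conv_eq_sum]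

lemma conv_ones_comm (p q : ℕ → R) : conv (ones p) (ones q) = conv (ones q) (ones p) := by
  rw [conv_ones, conv_ones]
  congr 1
  funext n
  rw [← Finset.Nat.sum_antidiagonal_swap]
  simp [mul_comm]

lemma dagger_ones (p : ℕ → R) : dagger (ones p) = ones fun n => (-1) ^ n * p n := by
  funext w
  simp only [dagger, ones, List.mem_reverse, List.length_reverse]
  split_ifs with h
  · rw [List.eq_replicate_of_mem h]; simp
  · simp

/-- Dual of multiplication by the letter `1` in the stuffle algebra. -/
def nabla : (List ℕ → R) → List ℕ → R
  | f, [] => f [1]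
  | f, b :: v => f (1 :: b :: v) + nabla (fun w => f (b :: w)) v + f ((1 + b) :: v)

lemma nabla_eq (f : List ℕ → R) (v : List ℕ) : nabla f v = ((stuffle [1] v).map f).sum := by
  induction v generalizing f with
  | nil => simp [nabla, stuffle]
  | cons b v ih =>
    simp [nabla, stuffle, ih, Multiset.map_map, add_assoc]

lemma nabla_add (f g : List ℕ → R) (v : List ℕ) :
    nabla (fun w => f w + g w) v = nabla f v + nabla g v := by
  simp [nabla_eq]

lemma nabla_smul (c : R) (f : List ℕ → R) (v : List ℕ) :
    nabla (fun w => c * f w) v = c * nabla f v := by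
  simp [nabla_eq, Multiset.sum_map_mul_left]

lemma nabla_conv (f g : List ℕ → R) (v : List ℕ) :
    nabla (conv f g) v = conv (nabla f) g v + conv f (nabla g) v := by
  induction v generalizing f with
  | nil => simp [nabla, conv_cons, add_comm]
  | cons b v ih =>
    have h1 : nabla (fun w => conv f g (b :: w)) v =
        f [] * nabla (fun w => g (b :: w)) v + (conv (nabla fun w => f (b :: w)) g v +
          conv (fun w => f (b :: w)) (nabla g) v) := by
      simp only [conv_cons f g, ← ih]
      rw [nabla_add (fun w => f [] * g (b :: w)), nabla_smul]
    have h2 : conv (fun w => nabla f (b :: w)) g v = conv (fun w => f (1 :: b :: w)) g v +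
        conv (nabla fun w => f (b :: w)) g v + conv (fun w => f ((1 + b) :: w)) g v := by
      rw [← conv_add_left, ← conv_add_left]
      rfl
    rw [nabla, h1, conv_cons _ _ b, h2, conv_cons _ _ b, conv_cons f g 1, conv_cons f g (1 + b)]
    simp only [nabla, conv_cons (fun w => f (1 :: w))]
    ring

lemma nabla_one (v : List ℕ) : nabla (convOne : List ℕ → R) v = 0 := by
  induction v with
  | nil => simp [nabla, convOne]
  | cons b v ih =>
    have : nabla (fun w => (convOne : List ℕ → R) (b :: w)) v = 0 := by
      simp [nabla_eq, convOne]
    rw [nabla, this]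
    simp [convOne]

lemma nabla_geo (x : R) (v : List ℕ) : nabla (geo x) v = x * geo x v := by
  match v with
  | [] => simp [nabla, geo]
  | [k] => simp [nabla, geo, pow_add]
  | a :: b :: v =>
    have : nabla (fun w => geo x (a :: b :: w)) v = 0 := by simp [nabla_eq, geo]
    rw [nabla, nabla, this]
    simp [geo]

lemma nabla_qs (xs : List R) (v : List ℕ) : nabla (qs xs) v = xs.sum * qs xs v := by
  induction xs generalizing v with
  | nil => simp [qs, nabla_one]
  | cons x xs ih =>
    have h1 : nabla (geo x) = fun v => x * geo x v := funext fun v => nabla_geo x v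
    have h2 : nabla (qs xs) = fun v => xs.sum * qs xs v := funext fun v => ih v
    have h3 : conv (geo x) (fun v => xs.sum * qs xs v) v = xs.sum * conv (geo x) (qs xs) v := by
      simp only [conv_eq_sum, Finset.mul_sum]
      exact Finset.sum_congr rfl fun _ _ => by ring
    rw [qs_cons, nabla_conv, h1, h2, conv_smul_left, h3, List.sum_cons]
    ring

lemma nabla_replicate (f : List ℕ → R) (d : ℕ) :
    nabla f (List.replicate d 1) = (d + 1) * f (List.replicate (d + 1) 1) +
      ∑ i ∈ Finset.range d, f (List.replicate i 1 ++ 2 :: List.replicate (d - 1 - i) 1) := by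
  induction d generalizing f with
  | zero => simp [nabla]
  | succ d ih =>
    rw [List.replicate_succ, nabla, ih, Finset.sum_range_succ']
    have h : ∀ i, d + 1 - 1 - (i + 1) = d - 1 - i := by omega
    simp only [h, List.replicate_succ, List.cons_append]
    push_cast
    simp only [List.nil_append, Nat.sub_zero]
    ring

lemma nabla_ones (p : ℕ → R) (v : List ℕ) (hv : ∀ i ∈ v, 0 < i) :
    nabla (ones p) v = ones (fun n => (n + 1) * p (n + 1)) v := by
  induction v generalizing p with
  | nil => simp [nabla, ones]
  | cons b v ih =>
    have hb : 1 + b ≠ 1 := by have := hv b (by simp); omega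
    have ih' := fun p => ih p fun i hi => hv i (List.mem_cons_of_mem _ hi)
    rw [nabla, ones_cons_ne _ hb, add_zero, ones_cons_one]
    by_cases h1 : b = 1
    · subst h1
      simp only [ones_cons_one, ih']
      simp only [ones]
      split_ifs <;> push_cast <;> ring
    · simp only [ones_cons_ne _ h1]
      simp [nabla_eq]

end WordSeries

section Shift

open Finset.HasAntidiagonal (antidiagonal)

/-- A recursive form of `zetaA`. -/
noncomputable def zetaRec : (List ℕ → ℝ) → ℕ → List ℕ → ℝ
  | f, a, [] => if a = 0 then f [] else 0
  | f, a, x :: l => ∑ st ∈ antidiagonal a, (-1 : ℝ) ^ st.1 * (Nat.choose (x - 1 + st.1) st.1 : ℝ) *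
      zetaRec (fun w => f ((x + st.1) :: w)) st.2 l

lemma sum_filter_piFinset_succ (n a : ℕ) (F : (Fin (n + 1) → ℕ) → ℝ) :
    ∑ f ∈ (Fintype.piFinset fun _ : Fin (n + 1) => Finset.range (a + 1)).filter
        (fun f => ∑ i, f i = a), F f =
      ∑ st ∈ antidiagonal a, ∑ g ∈ (Fintype.piFinset fun _ : Fin n =>
        Finset.range (st.2 + 1)).filter (fun f => ∑ i, f i = st.2), F (Fin.cons st.1 g) := by
  have hmem : ∀ (m b : ℕ) (f : Fin m → ℕ), f ∈ (Fintype.piFinset fun _ : Fin m =>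
      Finset.range (b + 1)).filter (fun f => ∑ i, f i = b) ↔ ∑ i, f i = b := by
    intro m b f
    simp only [Finset.mem_filter, Fintype.mem_piFinset, Finset.mem_range, and_iff_right_iff_imp]
    rintro rfl i
    exact Nat.lt_succ_of_le (Finset.single_le_sum (fun _ _ => Nat.zero_le _) (Finset.mem_univ i))
  rw [Finset.sum_sigma']
  symm
  refine Finset.sum_bij' (fun p _ => Fin.cons p.1.1 p.2)
    (fun f _ => ⟨(f 0, ∑ i, Fin.tail f i), Fin.tail f⟩) ?_ ?_ ?_ ?_ ?_
  · rintro ⟨⟨s, t⟩, g⟩ h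
    simp only [Finset.mem_sigma, hmem, Finset.HasAntidiagonal.mem_antidiagonal] at h
    rw [hmem, Fin.sum_univ_succ]
    simp [h.2, h.1]
  · intro f h
    rw [hmem, Fin.sum_univ_succ] at h
    simp only [Finset.mem_sigma, hmem, Finset.HasAntidiagonal.mem_antidiagonal]
    exact ⟨h, trivial⟩
  · rintro ⟨⟨s, t⟩, g⟩ h
    simp only [Finset.mem_sigma, hmem, Finset.HasAntidiagonal.mem_antidiagonal] at h
    obtain ⟨h1, rfl⟩ := h
    simp
  · intro f _
    simp
  · intro f _
    rfl

lemma zetaA_eq_zetaRec (f : List ℕ → ℝ) (a : ℕ) (l : List ℕ) : zetaA f a l = zetaRec f a l := by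
  induction l generalizing f a with
  | nil =>
    rcases Nat.eq_zero_or_pos a with rfl | ha
    · simp [zetaA, zetaRec]
    · simp [zetaA, zetaRec, ha.ne, ha.ne']
  | cons x l ih =>
    rw [zetaRec, zetaA]
    simp only [List.length_cons]
    rw [sum_filter_piFinset_succ, Finset.mul_sum]
    refine Finset.sum_congr rfl fun st hst => ?_
    rw [← ih, zetaA, ← Finset.HasAntidiagonal.mem_antidiagonal.1 hst, pow_add, Finset.mul_sum, Finset.mul_sum,
      Finset.mul_sum]
    refine Finset.sum_congr rfl fun g _ => ?_
    simp only [List.ofFn_succ, Fin.prod_univ_succ]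
    simp only [List.get_eq_getElem, Fin.val_zero, List.getElem_cons_zero, Fin.cons_zero,
      Fin.val_succ, List.getElem_cons_succ, Fin.cons_succ]
    ring

/-- The generating series of `zetaA`. -/
noncomputable def shiftSeries (f : List ℕ → ℝ) (w : List ℕ) : PowerSeries ℝ :=
  PowerSeries.mk fun a => zetaA f a w

lemma coeff_shiftSeries_cons (f : List ℕ → ℝ) (a x : ℕ) (l : List ℕ) :
    PowerSeries.coeff a (shiftSeries f (x :: l)) = ∑ st ∈ antidiagonal a,
      (-1 : ℝ) ^ st.1 * (Nat.choose (x - 1 + st.1) st.1 : ℝ) *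
        PowerSeries.coeff st.2 (shiftSeries (fun w => f ((x + st.1) :: w)) l) := by
  simp only [shiftSeries, PowerSeries.coeff_mk, zetaA_eq_zetaRec, zetaRec]

lemma shiftSeries_nil (f : List ℕ → ℝ) : shiftSeries f [] = PowerSeries.C (f []) := by
  ext a
  rw [PowerSeries.coeff_C, shiftSeries, PowerSeries.coeff_mk, zetaA_eq_zetaRec, zetaRec]

lemma zetaA_add (f g : List ℕ → ℝ) (a : ℕ) (l : List ℕ) :
    zetaA (fun w => f w + g w) a l = zetaA f a l + zetaA g a l := by
  simp only [zetaA, add_mul, Finset.sum_add_distrib, mul_add]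

lemma zetaA_smul (c : ℝ) (f : List ℕ → ℝ) (a : ℕ) (l : List ℕ) :
    zetaA (fun w => c * f w) a l = c * zetaA f a l := by
  simp only [zetaA, Finset.mul_sum]
  exact Finset.sum_congr rfl fun _ _ => by ring

lemma shiftSeries_conv (f g : List ℕ → ℝ) :
    shiftSeries (conv f g) = conv (shiftSeries f) (shiftSeries g) := by
  funext w
  induction w generalizing f with
  | nil => simp [shiftSeries_nil]
  | cons x l ih =>
    ext a
    have hsplit : ∀ (b s : ℕ), PowerSeries.coeff b
        (shiftSeries (fun w => conv f g ((x + s) :: w)) l) =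
        f [] * PowerSeries.coeff b (shiftSeries (fun w => g ((x + s) :: w)) l) +
          PowerSeries.coeff b (conv (shiftSeries fun w => f ((x + s) :: w)) (shiftSeries g) l) := by
      intro b s
      rw [← ih]
      simp only [shiftSeries, PowerSeries.coeff_mk, ← zetaA_smul, ← zetaA_add]
      rfl
    rw [conv_cons, map_add, shiftSeries_nil, PowerSeries.coeff_C_mul, coeff_shiftSeries_cons,
      coeff_shiftSeries_cons]
    simp only [hsplit, mul_add, Finset.sum_add_distrib, Finset.mul_sum]
    congr 1
    · exact Finset.sum_congr rfl fun _ _ => by ring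
    · simp only [conv_eq_sum, map_sum, Finset.mul_sum]
      rw [Finset.sum_comm]
      refine Finset.sum_congr rfl fun j _ => ?_
      simp only [PowerSeries.coeff_mul, coeff_shiftSeries_cons, Finset.mul_sum, Finset.sum_mul]
      rw [Finset.sum_sigma', Finset.sum_sigma']
      refine Finset.sum_bij' (fun p _ => ⟨(p.1.1 + p.2.1, p.2.2), (p.1.1, p.2.1)⟩)
        (fun p _ => ⟨(p.2.1, p.2.2 + p.1.2), (p.2.2, p.1.2)⟩) ?_ ?_ ?_ ?_ ?_
      · rintro ⟨⟨s, t⟩, p, q⟩ h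
        simp only [Finset.mem_sigma, Finset.HasAntidiagonal.mem_antidiagonal] at h ⊢
        exact ⟨by omega, trivial⟩
      · rintro ⟨⟨s, t⟩, p, q⟩ h
        simp only [Finset.mem_sigma, Finset.HasAntidiagonal.mem_antidiagonal] at h ⊢
        exact ⟨by omega, trivial⟩
      · rintro ⟨⟨s, t⟩, p, q⟩ h
        simp only [Finset.mem_sigma, Finset.HasAntidiagonal.mem_antidiagonal] at h
        obtain ⟨_, rfl⟩ := h
        rfl
      · rintro ⟨⟨s, t⟩, p, q⟩ h
        simp only [Finset.mem_sigma, Finset.HasAntidiagonal.mem_antidiagonal] at h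
        obtain ⟨_, rfl⟩ := h
        rfl
      · intro _ _
        ring

/-- The power series `x / (1 + x X)`. -/
noncomputable def pointSeries (x : ℝ) : PowerSeries ℝ :=
  PowerSeries.mk fun a => (-1) ^ a * x ^ (a + 1)

lemma coeff_pointSeries_pow (x : ℝ) {k : ℕ} (hk : 0 < k) (a : ℕ) :
    PowerSeries.coeff a (pointSeries x ^ k) =
      (-1) ^ a * (Nat.choose (k - 1 + a) a : ℝ) * x ^ (k + a) := by
  have h : pointSeries x = PowerSeries.C x *
      PowerSeries.rescale (-x) (PowerSeries.mk 1) := by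
    ext n
    simp only [pointSeries, PowerSeries.coeff_mk, PowerSeries.coeff_C_mul,
      PowerSeries.coeff_rescale, Pi.one_apply]
    rw [neg_pow]; ring
  obtain ⟨d, rfl⟩ : ∃ d, k = d + 1 := ⟨k - 1, by omega⟩
  rw [h, mul_pow, ← map_pow, ← map_pow, PowerSeries.mk_one_pow_eq_mk_choose_add,
    PowerSeries.coeff_C_mul, PowerSeries.coeff_rescale, PowerSeries.coeff_mk, Nat.add_sub_cancel,
    Nat.choose_symm_add, neg_pow]
  ring

lemma pointSeries_mul (x : ℝ) :
    pointSeries x * (1 + PowerSeries.C x * PowerSeries.X) = PowerSeries.C x := by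
  ext n
  rw [mul_add, mul_one, map_add, ← mul_assoc, mul_comm (pointSeries x), mul_assoc,
    PowerSeries.coeff_C_mul]
  cases n with
  | zero => simp [pointSeries]
  | succ n =>
    rw [PowerSeries.coeff_succ_mul_X, PowerSeries.coeff_C, if_neg n.succ_ne_zero]
    simp only [pointSeries, PowerSeries.coeff_mk]
    ring

lemma shiftSeries_geo (x : ℝ) (w : List ℕ) (hw : ∀ i ∈ w, 0 < i) :
    shiftSeries (geo x) w = geo (pointSeries x) w := by
  match w with
  | [] => simp [shiftSeries_nil, geo]
  | [k] =>
    ext a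
    rw [geo, coeff_pointSeries_pow x (hw k (by simp)), coeff_shiftSeries_cons]
    rw [Finset.sum_eq_single (a, 0)]
    · simp [shiftSeries_nil, geo]
    · rintro ⟨s, t⟩ h1 h2
      have : t ≠ 0 := by
        rintro rfl
        simp at h1
        exact h2 (by rw [h1])
      simp [shiftSeries_nil, PowerSeries.coeff_C, this]
    · simp
  | b :: c :: v =>
    ext a
    rw [coeff_shiftSeries_cons]
    simp only [coeff_shiftSeries_cons, geo]
    have : ∀ b, PowerSeries.coeff b (shiftSeries (fun _ => 0) v) = 0 := by
      intro b
      simpa [shiftSeries] using zetaA_smul 0 (fun _ => 0) b v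
    simp [this]

lemma shiftSeries_one (w : List ℕ) : shiftSeries convOne w = convOne w := by
  have h0 : (convOne : List ℕ → ℝ) = convOne := rfl
  cases w with
  | nil => simp [shiftSeries_nil, convOne]
  | cons b v =>
    ext a
    rw [coeff_shiftSeries_cons]
    have : ∀ b, PowerSeries.coeff b (shiftSeries (fun _ => 0) v) = 0 := by
      intro b
      simpa [shiftSeries] using zetaA_smul 0 (fun _ => 0) b v
    simp [this, convOne]

lemma shiftSeries_qs (xs : List ℝ) (w : List ℕ) (hw : ∀ i ∈ w, 0 < i) :
    shiftSeries (qs xs) w = qs (xs.map pointSeries) w := by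
  induction xs generalizing w with
  | nil => exact shiftSeries_one w
  | cons x xs ih =>
    rw [qs_cons, shiftSeries_conv, List.map_cons, qs_cons]
    exact conv_congr (fun j => shiftSeries_geo x _ fun i hi => hw i (List.mem_of_mem_take hi))
      fun j => ih _ fun i hi => hw i (List.mem_of_mem_drop hi)

lemma shiftSeries_ones (p : ℕ → ℝ) (w : List ℕ) (hw : ∀ i ∈ w, 0 < i) :
    shiftSeries (ones p) w = PowerSeries.C (ones p w) := by
  induction w generalizing p with
  | nil => rw [shiftSeries_nil]
  | cons b v ih =>
    have hz : ∀ b, PowerSeries.coeff b (shiftSeries (fun _ => 0) v) = 0 := by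
      intro b
      simpa [shiftSeries] using zetaA_smul 0 (fun _ => 0) b v
    ext a
    rw [coeff_shiftSeries_cons, Finset.sum_eq_single (0, a)]
    · by_cases hb : b = 1
      · subst hb
        simp only [add_zero, ones_cons_one]
        have := ih (fun n => p (n + 1)) fun i hi => hw i (List.mem_cons_of_mem _ hi)
        simp [this]
      · simp only [add_zero, ones_cons_ne _ hb, hz]
        simp
    · rintro ⟨s, t⟩ h1 h2
      have hs : s ≠ 0 := by
        rintro rfl
        simp at h1
        exact h2 (by rw [h1])
      have : b + s ≠ 1 := by have := hw b (by simp); omega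
      simp only [ones_cons_ne _ this, hz, mul_zero]
    · simp

end Shift

section Defect

/-- The generating series of the signed, reversed values attached to negative indices. -/
noncomputable def leftSeries (f : List ℕ → ℝ) : List ℕ → PowerSeries ℝ :=
  dagger fun w => PowerSeries.rescale (-1 : ℝ) (shiftSeries f w)

lemma leftSeries_conv (f g : List ℕ → ℝ) :
    leftSeries (conv f g) = conv (leftSeries g) (leftSeries f) := by
  simp only [leftSeries, shiftSeries_conv, map_conv]
  exact dagger_conv _ _

lemma coeff_leftSeries (f : List ℕ → ℝ) (w : List ℕ) (a : ℕ) :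
    PowerSeries.coeff a (leftSeries f w) = (-1) ^ (w.sum + a) * zetaA f a w.reverse := by
  have : ((-1 : PowerSeries ℝ)) = PowerSeries.C (-1 : ℝ) := by simp
  rw [leftSeries, dagger, this, ← map_pow, PowerSeries.coeff_C_mul, PowerSeries.coeff_rescale,
    shiftSeries, PowerSeries.coeff_mk, pow_add, mul_assoc]

lemma leftSeries_qs (xs : List ℝ) (w : List ℕ) (hw : ∀ i ∈ w, 0 < i) :
    leftSeries (qs xs) w = qs (xs.reverse.map fun x => pointSeries (-x)) w := by
  have h1 : leftSeries (qs xs) w = dagger (fun w => PowerSeries.rescale (-1 : ℝ)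
      (qs (xs.map pointSeries) w)) w := by
    rw [leftSeries, dagger, dagger, shiftSeries_qs _ _ (by simpa using hw)]
  have h2 : ∀ x : ℝ, -(PowerSeries.rescale (-1 : ℝ) (pointSeries x)) = pointSeries (-x) := by
    intro x
    ext n
    simp only [map_neg, PowerSeries.coeff_rescale, pointSeries, PowerSeries.coeff_mk]
    rw [neg_pow x]
    ring
  rw [h1]
  simp only [map_qs]
  rw [dagger_qs, List.map_map, ← List.map_reverse, List.map_map]
  congr 2
  funext x
  exact h2 x

lemma leftSeries_ones (p : ℕ → ℝ) (w : List ℕ) (hw : ∀ i ∈ w, 0 < i) :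
    leftSeries (ones p) w = PowerSeries.C (ones (fun n => (-1) ^ n * p n) w) := by
  rw [← dagger_ones, leftSeries, dagger, dagger, shiftSeries_ones _ _ (by simpa using hw)]
  have hC : ∀ r : ℝ, PowerSeries.rescale (-1 : ℝ) (PowerSeries.C r) = PowerSeries.C r := by
    intro r
    ext n
    rw [PowerSeries.coeff_rescale, PowerSeries.coeff_C]
    split_ifs with h <;> simp [h]
  rw [hC, map_mul]
  simp

/-- The Laurent series at the origin of the multitangent built from `f` on the negative
indices and from `g` on the positive ones. -/
noncomputable def tangentSeries (f g : List ℕ → ℝ) : List ℕ → LaurentSeries ℝ :=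
  conv (fun w => HahnSeries.ofPowerSeries ℤ ℝ (leftSeries f w))
    (conv (geo (HahnSeries.single (-1 : ℤ) (1 : ℝ)))
      fun w => HahnSeries.ofPowerSeries ℤ ℝ (shiftSeries g w))

lemma zetaA_zero (f : List ℕ → ℝ) (l : List ℕ) : zetaA f 0 l = f l := by
  rw [zetaA_eq_zetaRec]
  induction l generalizing f with
  | nil => simp [zetaRec]
  | cons x l ih => simp [zetaRec, ih]

lemma coeff_tangentSeries (f g : List ℕ → ℝ) (k : List ℕ) (c : ℕ) :
    (tangentSeries f g k).coeff (-(c : ℤ)) =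
      (if c = 0 then ∑ j ∈ Finset.range (k.length + 1),
        (-1 : ℝ) ^ (k.take j).sum * f ((k.take j).reverse) * g (k.drop j) else 0) +
      ∑ j ∈ Finset.range k.length, if c ≤ k.getD j 0 then
        ∑ a ∈ Finset.range (k.getD j 0 - c + 1),
          (-1 : ℝ) ^ ((k.take j).sum + a) * zetaA f a ((k.take j).reverse) *
            zetaA g (k.getD j 0 - c - a) (k.drop (j + 1)) else 0 := by
  have hsum : ∀ (s : Finset ℕ) (F : ℕ → LaurentSeries ℝ) (i : ℤ),
      (∑ j ∈ s, F j).coeff i = ∑ j ∈ s, (F j).coeff i := by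
    intro s F i
    induction s using Finset.cons_induction with
    | empty => simp
    | cons a s ha ih => simp
  rw [tangentSeries, conv_geo_conv, HahnSeries.coeff_add, hsum, hsum]
  congr 1
  · split_ifs with hc
    · subst hc
      refine Finset.sum_congr rfl fun j _ => ?_
      rw [← map_mul, PowerSeries.coeff_coe]
      simp only [CharP.cast_eq_zero, neg_zero, lt_self_iff_false, if_false, Int.natAbs_zero]
      rw [PowerSeries.coeff_mul]
      rw [Finset.Nat.antidiagonal_zero, Finset.sum_singleton]
      rw [coeff_leftSeries, zetaA_zero, shiftSeries, PowerSeries.coeff_mk, zetaA_zero, add_zero]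
    · refine Finset.sum_eq_zero fun j _ => ?_
      rw [← map_mul, PowerSeries.coeff_coe, if_pos (by omega)]
  · refine Finset.sum_congr rfl fun j _ => ?_
    rw [HahnSeries.single_pow, mul_right_comm, ← map_mul, HahnSeries.coeff_mul_single,
      PowerSeries.coeff_coe]
    simp only [one_pow, mul_one, smul_neg, nsmul_eq_mul, sub_neg_eq_add]
    by_cases h : c ≤ k.getD j 0
    · rw [if_neg (by omega), if_pos h, PowerSeries.coeff_mul,
        show (-(c : ℤ) + (k.getD j 0 : ℕ)).natAbs = k.getD j 0 - c by omega,
        Finset.Nat.sum_antidiagonal_eq_sum_range_succ_mk]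
      refine Finset.sum_congr rfl fun a _ => ?_
      rw [coeff_leftSeries, shiftSeries, PowerSeries.coeff_mk]
    · rw [if_pos (by omega), if_neg h]

/-- The linear functional extracting the constant term and subtracting the contribution of
the polar part. -/
noncomputable def polarDefect (C : ℕ) (s : ℕ → ℝ) : LaurentSeries ℝ →ₗ[ℝ] ℝ where
  toFun F := F.coeff 0 - ∑ m ∈ Finset.Icc 1 C, s m * F.coeff (-((2 * m : ℕ) : ℤ))
  map_add' F G := by
    simp only [HahnSeries.coeff_add, mul_add, Finset.sum_add_distrib]
    ring
  map_smul' r F := by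
    simp only [HahnSeries.coeff_smul, smul_eq_mul, RingHom.id_apply, mul_sub, Finset.mul_sum]
    congr 1
    exact Finset.sum_congr rfl fun _ _ => by ring

/-- The difference of the two sides of the constant term identity without its `δ` term, with
`2ζ(2m)` replaced by `s m`. -/
noncomputable def defect (f : List ℕ → ℝ) (s : ℕ → ℝ) (k : List ℕ) : ℝ :=
  ((∑ j ∈ Finset.range (k.length + 1),
        (-1 : ℝ) ^ (k.take j).sum * f ((k.take j).reverse) * f (k.drop j)) +
      ∑ j ∈ Finset.range k.length, ∑ a ∈ Finset.range (k.getD j 0 + 1),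
        (-1 : ℝ) ^ ((k.take j).sum + a) * zetaA f a ((k.take j).reverse) *
          zetaA f (k.getD j 0 - a) (k.drop (j + 1))) -
    ∑ j ∈ Finset.range k.length, ∑ m ∈ Finset.Icc 1 (k.getD j 0 / 2),
        ∑ a ∈ Finset.range (k.getD j 0 - 2 * m + 1),
          (-1 : ℝ) ^ ((k.take j).sum + a) * zetaA f a ((k.take j).reverse) *
            zetaA f (k.getD j 0 - 2 * m - a) (k.drop (j + 1)) * s m

lemma getD_le_sum (k : List ℕ) (j : ℕ) : k.getD j 0 ≤ k.sum := by
  rcases lt_or_ge j k.length with h | h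
  · rw [List.getD_eq_getElem _ _ h]
    exact List.le_sum_of_mem (List.getElem_mem h)
  · rw [List.getD_eq_default _ _ h]
    exact Nat.zero_le _

lemma defect_eq (f : List ℕ → ℝ) (s : ℕ → ℝ) (k : List ℕ) (C : ℕ) (hC : k.sum ≤ C) :
    defect f s k = polarDefect C s (tangentSeries f f k) := by
  have h0 := coeff_tangentSeries f f k 0
  simp only [CharP.cast_eq_zero, neg_zero, if_true, Nat.zero_le, Nat.sub_zero] at h0
  rw [defect, polarDefect]
  simp only [LinearMap.coe_mk, AddHom.coe_mk, h0]
  congr 1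
  simp only [coeff_tangentSeries]
  have : ∀ m ∈ Finset.Icc 1 C, 2 * m ≠ 0 := fun m hm => by
    have := (Finset.mem_Icc.1 hm).1; omega
  symm
  refine (Finset.sum_congr rfl fun m hm => by
    rw [if_neg (this m hm), zero_add, Finset.mul_sum]).trans ?_
  rw [Finset.sum_comm]
  refine Finset.sum_congr rfl fun j _ => ?_
  have hsub : Finset.Icc 1 (k.getD j 0 / 2) ⊆ Finset.Icc 1 C := by
    have := getD_le_sum k j
    exact Finset.Icc_subset_Icc le_rfl (by omega)
  rw [← Finset.sum_subset hsub]
  · refine Finset.sum_congr rfl fun m hm => ?_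
    rw [if_pos (by have := (Finset.mem_Icc.1 hm).2; omega), Finset.mul_sum]
    exact Finset.sum_congr rfl fun _ _ => by ring
  · intro m hm hm'
    rw [if_neg, mul_zero]
    intro h
    exact hm' (Finset.mem_Icc.2 ⟨(Finset.mem_Icc.1 hm).1, by omega⟩)

lemma tangentSeries_conv_ones (f : List ℕ → ℝ) (p : ℕ → ℝ) (w : List ℕ) (hw : ∀ i ∈ w, 0 < i) :
    tangentSeries (conv f (ones p)) (conv f (ones p)) w =
      conv (fun w => (HahnSeries.C : ℝ →+* LaurentSeries ℝ) (ones (fun n => (-1) ^ n * p n) w))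
        (conv (tangentSeries f f) fun w => (HahnSeries.C : ℝ →+* LaurentSeries ℝ) (ones p w)) w := by
  have hC : ∀ r : ℝ, (HahnSeries.C : ℝ →+* LaurentSeries ℝ) r =
      HahnSeries.ofPowerSeries ℤ ℝ (PowerSeries.C r) := by
    intro r
    rw [HahnSeries.ofPowerSeries_C]
  rw [tangentSeries, leftSeries_conv, shiftSeries_conv]
  simp only [map_conv]
  rw [conv_assoc, tangentSeries, conv_assoc, conv_assoc]
  refine conv_congr (fun j => ?_) fun j => ?_
  · rw [leftSeries_ones _ _ fun i hi => hw i (List.mem_of_mem_take hi), hC]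
  · refine conv_congr (fun _ => rfl) fun j' => ?_
    refine conv_congr (fun _ => rfl) fun j'' => ?_
    refine conv_congr (fun _ => rfl) fun j''' => ?_
    rw [shiftSeries_ones, hC]
    exact fun i hi => hw i (List.mem_of_mem_drop (List.mem_of_mem_drop
      (List.mem_of_mem_drop (List.mem_of_mem_drop hi))))

lemma defect_conv_ones (f : List ℕ → ℝ) (s : ℕ → ℝ) (p : ℕ → ℝ) (w : List ℕ)
    (hw : ∀ i ∈ w, 0 < i) :
    defect (conv f (ones p)) s w =
      conv (ones fun n => (-1) ^ n * p n) (conv (defect f s) (ones p)) w := by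
  have hle : ∀ (w : List ℕ) j, (w.take j).sum ≤ w.sum ∧ (w.drop j).sum ≤ w.sum := by
    intro w j
    have := List.sum_take_add_sum_drop w j
    omega
  rw [defect_eq _ s w w.sum le_rfl, tangentSeries_conv_ones f p w hw]
  simp only [conv_eq_sum, map_sum]
  refine Finset.sum_congr rfl fun j _ => ?_
  rw [HahnSeries.C_mul_eq_smul, map_smul, smul_eq_mul, map_sum]
  congr 1
  refine Finset.sum_congr rfl fun i _ => ?_
  rw [mul_comm (tangentSeries f f _), HahnSeries.C_mul_eq_smul, map_smul, smul_eq_mul, mul_comm,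
    defect_eq f s _ w.sum]
  exact ((hle _ _).1.trans (hle w j).2)

end Defect

section PartialFractions

variable {A : Type*} [CommRing A] [Module ℝ A]

/-- The span of the simple fractions `x m ^ c` with `m ∈ S` and `1 ≤ c ≤ C`. -/
def fractionSpan (x : ℤ → A) (S : Set ℤ) (C : ℕ) : Submodule ℝ A :=
  Submodule.span ℝ {z | ∃ m ∈ S, ∃ c, 1 ≤ c ∧ c ≤ C ∧ z = x m ^ c}

lemma fractionSpan_mono (x : ℤ → A) (S : Set ℤ) {C D : ℕ} (h : C ≤ D) :
    fractionSpan x S C ≤ fractionSpan x S D := by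
  refine Submodule.span_mono ?_
  rintro z ⟨m, hm, c, h1, h2, rfl⟩
  exact ⟨m, hm, c, h1, h2.trans h, rfl⟩

lemma pow_mem_fractionSpan (x : ℤ → A) {S : Set ℤ} {m : ℤ} (hm : m ∈ S) {c C : ℕ} (hc : 1 ≤ c)
    (hC : c ≤ C) : x m ^ c ∈ fractionSpan x S C :=
  Submodule.subset_span ⟨m, hm, c, hc, hC, rfl⟩

variable [SMulCommClass ℝ A A]

lemma pow_mul_pow_mem_fractionSpan {x : ℤ → A} {T : A} (hx : ∀ m, x m * (T + (m : A)) = 1)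
    {S : Set ℤ} {m n : ℤ} (hm : m ∈ S) (hn : n ∈ S) (a b : ℕ) (hab : 0 < a + b) :
    x m ^ a * x n ^ b ∈ fractionSpan x S (a + b) := by
  by_cases hmn : m = n
  · subst hmn
    rw [← pow_add]
    exact pow_mem_fractionSpan x hm hab le_rfl
  have key : x m * x n = (((n - m : ℤ) : ℝ)⁻¹) • (x m - x n) := by
    have h1 : x m - x n = ((n - m : ℤ) : ℝ) • (x m * x n) := by
      rw [Int.cast_smul_eq_zsmul, zsmul_eq_mul]
      push_cast
      linear_combination x n * hx m - x m * hx n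
    have h2 : ((n - m : ℤ) : ℝ) ≠ 0 := by exact_mod_cast sub_ne_zero.2 (Ne.symm hmn)
    rw [h1, smul_smul, inv_mul_cancel₀ h2, one_smul]
  induction hd : a + b generalizing a b with
  | zero => omega
  | succ d ih =>
    rcases a with _ | a
    · rw [pow_zero, one_mul]
      exact pow_mem_fractionSpan x hn (by omega) (by omega)
    rcases b with _ | b
    · rw [pow_zero, mul_one]
      exact pow_mem_fractionSpan x hm (by omega) (by omega)
    have e : x m ^ (a + 1) * x n ^ (b + 1) = (((n - m : ℤ) : ℝ)⁻¹) •
        (x m ^ (a + 1) * x n ^ b - x m ^ a * x n ^ (b + 1)) := by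
      calc x m ^ (a + 1) * x n ^ (b + 1) = x m ^ a * x n ^ b * (x m * x n) := by ring
        _ = _ := by
          rw [key, mul_smul_comm]
          congr 1
          ring
    rw [e]
    refine Submodule.smul_mem _ _ (fractionSpan_mono x S d.le_succ (Submodule.sub_mem _ ?_ ?_))
    · exact ih _ _ (by omega) (by omega)
    · exact ih _ _ (by omega) (by omega)

variable [IsScalarTower ℝ A A]

lemma mul_mem_fractionSpan {x : ℤ → A} {T : A} (hx : ∀ m, x m * (T + (m : A)) = 1)
    {S : Set ℤ} {C D : ℕ} {u v : A} (hu : u ∈ fractionSpan x S C) (hv : v ∈ fractionSpan x S D) :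
    u * v ∈ fractionSpan x S (C + D) := by
  induction hu using Submodule.span_induction with
  | zero => simp
  | add u u' _ _ h h' => rw [add_mul]; exact Submodule.add_mem _ h h'
  | smul r u _ h => rw [smul_mul_assoc]; exact Submodule.smul_mem _ _ h
  | mem u hu =>
    obtain ⟨m, hm, a, ha, ha', rfl⟩ := hu
    induction hv using Submodule.span_induction with
    | zero => simp
    | add u u' _ _ h h' => rw [mul_add]; exact Submodule.add_mem _ h h'
    | smul r u _ h => rw [mul_smul_comm]; exact Submodule.smul_mem _ _ h
    | mem v hv =>
      obtain ⟨n, hn, b, hb, hb', rfl⟩ := hv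
      exact fractionSpan_mono x S (by omega)
        (pow_mul_pow_mem_fractionSpan hx hm hn a b (by omega))

lemma qs_mem_fractionSpan {x : ℤ → A} {T : A} (hx : ∀ m, x m * (T + (m : A)) = 1)
    {S : Set ℤ} (ms : List ℤ) (hms : ∀ m ∈ ms, m ∈ S) (k : List ℕ) (hk0 : k ≠ [])
    (hk : ∀ i ∈ k, 0 < i) : qs (ms.map x) k ∈ fractionSpan x S k.sum := by
  induction ms generalizing k with
  | nil =>
    obtain ⟨b, v, rfl⟩ := List.exists_cons_of_ne_nil hk0
    simp [qs, convOne]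
  | cons m ms ih =>
    have ih := ih fun m hm => hms m (List.mem_cons_of_mem _ hm)
    obtain ⟨b, v, rfl⟩ := List.exists_cons_of_ne_nil hk0
    rw [List.map_cons, qs_cons_cons]
    have hb : 0 < b := hk b (by simp)
    have hv : ∀ i ∈ v, 0 < i := fun i hi => hk i (List.mem_cons_of_mem _ hi)
    have hxm : x m ^ b ∈ fractionSpan x S b :=
      pow_mem_fractionSpan x (hms m (by simp)) hb le_rfl
    refine Submodule.add_mem _ (ih _ hk0 hk) ?_
    rw [List.sum_cons]
    by_cases hv0 : v = []
    · subst hv0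
      simpa using hxm
    · exact mul_mem_fractionSpan hx hxm (ih v hv0 hv)

end PartialFractions

section Expansion

/-- The Laurent expansion of `1 / (u + r)` at the origin. -/
noncomputable def poleSeries (r : ℝ) : LaurentSeries ℝ :=
  if r = 0 then HahnSeries.single (-1 : ℤ) 1 else HahnSeries.ofPowerSeries ℤ ℝ (pointSeries (1 / r))

lemma poleSeries_mul (r : ℝ) :
    poleSeries r * (HahnSeries.single (1 : ℤ) 1 + HahnSeries.C r) = 1 := by
  rw [poleSeries]
  split_ifs with h
  · subst h
    simp
  · have h1 := pointSeries_mul (1 / r)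
    have h2 : pointSeries (1 / r) * (PowerSeries.X + PowerSeries.C r) = 1 := by
      have h3 : PowerSeries.C r * PowerSeries.C (1 / r) = (1 : PowerSeries ℝ) := by
        rw [← map_mul, mul_one_div_cancel h, map_one]
      linear_combination PowerSeries.C r * h1 + (1 - pointSeries (1 / r) * PowerSeries.X) * h3
    rw [← HahnSeries.ofPowerSeries_C, ← HahnSeries.ofPowerSeries_X, ← map_add, ← map_mul, h2,
      map_one]

lemma coeff_poleSeries_zero_pow (c : ℕ) (i : ℤ) :
    (poleSeries 0 ^ c).coeff i = if i = -(c : ℤ) then 1 else 0 := by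
  rw [poleSeries, if_pos rfl, HahnSeries.single_pow, HahnSeries.coeff_single]
  simp

lemma coeff_poleSeries_pow {r : ℝ} (hr : r ≠ 0) (c : ℕ) {i : ℤ} (hi : i < 0) :
    (poleSeries r ^ c).coeff i = 0 := by
  rw [poleSeries, if_neg hr, ← map_pow, PowerSeries.coeff_coe, if_pos hi]

lemma coeff_zero_poleSeries_pow {r : ℝ} (hr : r ≠ 0) {c : ℕ} (hc : 0 < c) :
    (poleSeries r ^ c).coeff 0 = (1 / r) ^ c := by
  rw [poleSeries, if_neg hr, ← map_pow, PowerSeries.coeff_coe, if_neg (lt_irrefl _),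
    Int.natAbs_zero, coeff_pointSeries_pow _ hc]
  simp

/-- A simple fraction with pole at `-m`, evaluated at `z`, together with its Laurent expansions
at all points `-n`. -/
noncomputable def fractionData (z : ℂ) (m : ℤ) : ℂ × (ℤ → LaurentSeries ℝ) :=
  (1 / (z + m), fun n => poleSeries ((m - n : ℤ) : ℝ))

lemma laurent_smul_mul (r : ℝ) (a b : LaurentSeries ℝ) : (r • a) * b = r • (a * b) := by
  rw [← HahnSeries.C_mul_eq_smul, ← HahnSeries.C_mul_eq_smul, mul_assoc]

instance : IsScalarTower ℝ (ℂ × (ℤ → LaurentSeries ℝ)) (ℂ × (ℤ → LaurentSeries ℝ)) :=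
  ⟨fun r a b => Prod.ext (smul_mul_assoc r a.1 b.1)
    (funext fun n => laurent_smul_mul r (a.2 n) (b.2 n))⟩

instance : SMulCommClass ℝ (ℂ × (ℤ → LaurentSeries ℝ)) (ℂ × (ℤ → LaurentSeries ℝ)) :=
  ⟨fun r a b => Prod.ext (mul_smul_comm r a.1 b.1).symm (funext fun n => by
    change r • (a.2 n * b.2 n) = a.2 n * (r • b.2 n)
    rw [mul_comm, ← laurent_smul_mul, mul_comm])⟩

lemma fractionData_mul {z : ℂ} (hz : ∀ m : ℤ, z + m ≠ 0) (m : ℤ) :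
    fractionData z m * (((z, fun n : ℤ => HahnSeries.single (1 : ℤ) 1 - (n : LaurentSeries ℝ)) :
      ℂ × (ℤ → LaurentSeries ℝ)) +
      (m : ℂ × (ℤ → LaurentSeries ℝ))) = 1 := by
  refine Prod.ext ?_ (funext fun n => ?_)
  · simp [fractionData, hz m]
  · have := poleSeries_mul ((m - n : ℤ) : ℝ)
    have hC : HahnSeries.C (((m - n : ℤ) : ℝ)) = ((m : LaurentSeries ℝ) - (n : LaurentSeries ℝ)) := by
      rw [map_intCast, Int.cast_sub]
    rw [hC] at this
    simp only [fractionData, Prod.snd_mul, Pi.mul_apply, Prod.snd_add, Pi.add_apply,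
      Prod.snd_one, Pi.one_apply, Prod.snd_intCast, Pi.intCast_apply]
    rw [← this]
    ring

lemma fst_eq_of_mem_fractionSpan (z : ℂ) (S : Finset ℤ) (C : ℕ)
    {w : ℂ × (ℤ → LaurentSeries ℝ)} (hw : w ∈ fractionSpan (fractionData z) S C) :
    w.1 = ∑ n ∈ S, ∑ c ∈ Finset.Icc 1 C,
      (((w.2 n).coeff (-(c : ℤ)) : ℝ) : ℂ) * (1 / (z + n)) ^ c := by
  induction hw using Submodule.span_induction with
  | zero => simp
  | add u v _ _ hu hv =>
    rw [Prod.fst_add, hu, hv]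
    simp [add_mul, Finset.sum_add_distrib]
  | smul r u _ hu =>
    rw [Prod.smul_fst, hu]
    simp [Finset.mul_sum, mul_assoc]
  | mem w hw =>
    obtain ⟨m, hm, c, hc, hcC, rfl⟩ := hw
    rw [Finset.sum_eq_single m, Finset.sum_eq_single c]
    · simp [fractionData, coeff_poleSeries_zero_pow]
    · intro b _ hb
      have : ¬ (b : ℤ) = c := by exact_mod_cast hb
      simp [fractionData, coeff_poleSeries_zero_pow, this]
    · intro h
      exact absurd (Finset.mem_Icc.2 ⟨hc, hcC⟩) h
    · intro n _ hn
      refine Finset.sum_eq_zero fun b hb => ?_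
      have h1 : ((m - n : ℤ) : ℝ) ≠ 0 := by exact_mod_cast sub_ne_zero.2 (Ne.symm hn)
      have h2 : -(b : ℤ) < 0 := by have := (Finset.mem_Icc.1 hb).1; omega
      rw [Prod.pow_snd, Pi.pow_apply, fractionData, coeff_poleSeries_pow h1 _ h2]
      simp
    · intro h
      exact absurd hm h

lemma coeff_zero_eq_of_mem_fractionSpan (z : ℂ) (S : Finset ℤ) (C : ℕ)
    {w : ℂ × (ℤ → LaurentSeries ℝ)} (hw : w ∈ fractionSpan (fractionData z) S C) :
    (w.2 0).coeff 0 = ∑ n ∈ S.erase 0, ∑ c ∈ Finset.Icc 1 C,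
      (w.2 n).coeff (-(c : ℤ)) * (1 / (n : ℝ)) ^ c := by
  induction hw using Submodule.span_induction with
  | zero => simp
  | add u v _ _ hu hv =>
    rw [Prod.snd_add, Pi.add_apply, HahnSeries.coeff_add, hu, hv]
    simp [add_mul, Finset.sum_add_distrib]
  | smul r u _ hu =>
    rw [Prod.smul_snd, Pi.smul_apply, HahnSeries.coeff_smul, hu]
    simp [Finset.mul_sum, mul_assoc]
  | mem w hw =>
    obtain ⟨m, hm, c, hc, hcC, rfl⟩ := hw
    have hz : ∀ n ∈ S.erase 0, n ≠ m → ∑ b ∈ Finset.Icc 1 C,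
        ((fractionData z m ^ c).2 n).coeff (-(b : ℤ)) * (1 / (n : ℝ)) ^ b = 0 := by
      intro n _ hn
      refine Finset.sum_eq_zero fun b hb => ?_
      have h1 : ((m - n : ℤ) : ℝ) ≠ 0 := by exact_mod_cast sub_ne_zero.2 (Ne.symm hn)
      have h2 : -(b : ℤ) < 0 := by have := (Finset.mem_Icc.1 hb).1; omega
      rw [Prod.pow_snd, Pi.pow_apply, fractionData, coeff_poleSeries_pow h1 _ h2]
      simp
    by_cases hm0 : m = 0
    · subst hm0
      rw [Finset.sum_eq_zero fun n hn => hz n hn (Finset.ne_of_mem_erase hn)]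
      have : ¬ (c = 0) := by omega
      simp [fractionData, coeff_poleSeries_zero_pow, this]
    · have hm' : ((m - 0 : ℤ) : ℝ) ≠ 0 := by simpa using hm0
      rw [Finset.sum_eq_single m hz, Finset.sum_eq_single c]
      · rw [Prod.pow_snd, Pi.pow_apply, Pi.pow_apply, fractionData,
          coeff_zero_poleSeries_pow hm' hc]
        simp [coeff_poleSeries_zero_pow]
      · intro b _ hb
        have : ¬ (b : ℤ) = c := by exact_mod_cast hb
        simp [fractionData, coeff_poleSeries_zero_pow, this]
      · intro h
        exact absurd (Finset.mem_Icc.2 ⟨hc, hcC⟩) h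
      · intro h
        exact absurd (Finset.mem_erase.2 ⟨hm0, hm⟩) h

/-- The truncated multiple zeta values (sums over indices at most `M`). -/
noncomputable def truncated (M : ℕ) : List ℕ → ℝ :=
  qs ((List.range M).map fun i : ℕ => 1 / ((i : ℝ) + 1))

lemma qs_poleSeries_eq (p q : ℕ) (k : List ℕ) (hk : ∀ i ∈ k, 0 < i) :
    qs ((List.range (p + (q + 1))).map fun i : ℕ => poleSeries (((i : ℤ) - p : ℤ) : ℝ)) k =
      tangentSeries (truncated p) (truncated q) k := by
  have hlist : ((List.range (p + (q + 1))).map fun i : ℕ => poleSeries (((i : ℤ) - p : ℤ) : ℝ)) =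
      ((((List.range p).map fun i : ℕ => 1 / ((i : ℝ) + 1)).reverse.map
        fun x => pointSeries (-x)).map (HahnSeries.ofPowerSeries ℤ ℝ)) ++
      (HahnSeries.single (-1 : ℤ) (1 : ℝ) ::
        (((List.range q).map fun i : ℕ => 1 / ((i : ℝ) + 1)).map pointSeries).map
          (HahnSeries.ofPowerSeries ℤ ℝ)) := by
    rw [List.range_add, List.map_append, List.range_succ_eq_map]
    congr 1
    · refine List.ext_getElem (by simp) fun i h1 h2 => ?_
      have hi : i < p := by simpa using h1
      simp only [List.getElem_map, List.getElem_range, List.getElem_reverse, List.length_map,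
        List.length_range]
      have h3 : (((i : ℤ) - p : ℤ) : ℝ) ≠ 0 := by
        have : (i : ℤ) - p ≠ 0 := by omega
        exact_mod_cast this
      rw [poleSeries, if_neg h3]
      congr 2
      have : ((p - 1 - i : ℕ) : ℝ) + 1 = -(((i : ℤ) - p : ℤ) : ℝ) := by
        rw [Nat.sub_sub, Nat.cast_sub (by omega)]
        push_cast
        ring
      rw [this]
      field_simp
    · rw [List.map_cons, List.map_cons]
      congr 1
      · simp [poleSeries]
      · refine List.ext_getElem (by simp) fun i h1 h2 => ?_
        simp only [List.getElem_map, List.getElem_range]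
        have h3 : (((p + (i + 1) : ℕ) : ℤ) - p : ℤ) = ((i + 1 : ℕ) : ℤ) := by push_cast; ring
        have h4 : ((i : ℝ) + 1) ≠ 0 := by positivity
        simp only [Nat.succ_eq_add_one, h3]
        push_cast
        rw [poleSeries, if_neg h4]
  rw [hlist, qs_append, qs_cons, tangentSeries]
  refine conv_congr (fun j => ?_) fun j => conv_congr (fun _ => rfl) fun j' => ?_
  · rw [← map_qs, truncated, leftSeries_qs]
    exact fun i hi => hk i (List.mem_of_mem_take hi)
  · rw [← map_qs, truncated, shiftSeries_qs]
    exact fun i hi => hk i (List.mem_of_mem_drop (List.mem_of_mem_drop hi))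

/-- The coefficients of the partial fraction expansion of a truncated multitangent. -/
noncomputable def polarCoeff (p q : ℕ) (k : List ℕ) (c : ℕ) : ℝ :=
  (tangentSeries (truncated p) (truncated q) k).coeff (-(c : ℤ))

/-- The truncated multitangent. -/
noncomputable def multitangent (N : ℕ) (z : ℂ) : List ℕ → ℂ :=
  qs ((List.range (2 * N + 1)).map fun i : ℕ => 1 / (z + ((i : ℤ) - N : ℤ)))

lemma multitangent_expansion (N : ℕ) {z : ℂ} (hz : ∀ m : ℤ, z + m ≠ 0) (k : List ℕ) (hk0 : k ≠ [])
    (hk : ∀ i ∈ k, 0 < i) :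
    multitangent N z k = ∑ n ∈ Finset.Icc (-(N : ℤ)) N, ∑ c ∈ Finset.Icc 1 k.sum,
        (polarCoeff (N + n).toNat (N - n).toNat k c : ℂ) * (1 / (z + n)) ^ c ∧
      polarCoeff N N k 0 = ∑ n ∈ (Finset.Icc (-(N : ℤ)) N).erase 0, ∑ c ∈ Finset.Icc 1 k.sum,
        polarCoeff (N + n).toNat (N - n).toNat k c * (1 / (n : ℝ)) ^ c := by
  set ms : List ℤ := (List.range (2 * N + 1)).map fun i : ℕ => (i : ℤ) - N with hms
  have hmem := qs_mem_fractionSpan (S := (Finset.Icc (-(N : ℤ)) N : Finset ℤ))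
    (fractionData_mul hz) ms (by
      intro m hm
      simp only [hms, List.mem_map, List.mem_range] at hm
      obtain ⟨i, hi, rfl⟩ := hm
      simp only [Finset.coe_Icc, Set.mem_Icc]
      omega) k hk0 hk
  have h1 : (qs (ms.map (fractionData z)) k).1 = multitangent N z k := by
    rw [multitangent]
    have := map_qs (RingHom.fst ℂ (ℤ → LaurentSeries ℝ)) (ms.map (fractionData z)) k
    rw [RingHom.coe_fst] at this
    rw [this, List.map_map, hms, List.map_map]
    rfl
  have h2 : ∀ n ∈ Finset.Icc (-(N : ℤ)) N, (qs (ms.map (fractionData z)) k).2 n =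
      tangentSeries (truncated (N + n).toNat) (truncated (N - n).toNat) k := by
    intro n hn
    rw [Finset.mem_Icc] at hn
    have := map_qs ((Pi.evalRingHom (fun _ : ℤ => LaurentSeries ℝ) n).comp
      (RingHom.snd ℂ (ℤ → LaurentSeries ℝ))) (ms.map (fractionData z)) k
    rw [← qs_poleSeries_eq _ _ k hk]
    refine this.trans ?_
    rw [List.map_map, hms, List.map_map, show 2 * N + 1 = (N + n).toNat + ((N - n).toNat + 1) by omega]
    congr 2
    funext i
    simp only [Function.comp, RingHom.comp_apply, fractionData, RingHom.coe_snd, Pi.evalRingHom_apply]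
    congr 2
    omega
  refine ⟨?_, ?_⟩
  · rw [← h1, fst_eq_of_mem_fractionSpan z _ _ hmem]
    refine Finset.sum_congr rfl fun n hn => ?_
    rw [h2 n hn]
    rfl
  · have := coeff_zero_eq_of_mem_fractionSpan z _ _ hmem
    rw [h2 0 (by simp)] at this
    simp only [add_zero, sub_zero, Int.toNat_natCast] at this
    rw [polarCoeff]
    simp only [CharP.cast_eq_zero, neg_zero, this]
    refine Finset.sum_congr rfl fun n hn => ?_
    rw [h2 n (Finset.mem_of_mem_erase hn)]
    rfl

end Expansion

section Growth

/-- Harmonic numbers. -/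
noncomputable def harm (M : ℕ) : ℝ := ∑ i ∈ Finset.range M, 1 / ((i : ℝ) + 1)

lemma harm_succ (M : ℕ) : harm (M + 1) = harm M + 1 / ((M : ℝ) + 1) := by
  rw [harm, Finset.sum_range_succ, harm]

lemma harm_mono {a b : ℕ} (h : a ≤ b) : harm a ≤ harm b :=
  Finset.sum_le_sum_of_subset_of_nonneg (Finset.range_mono h) fun _ _ _ => by positivity

lemma harm_nonneg (M : ℕ) : 0 ≤ harm M := Finset.sum_nonneg fun _ _ => by positivity

/-- A convenient majorant of logarithmic size. -/
noncomputable def logSize (N : ℕ) : ℝ := 1 + harm (2 * N)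

lemma one_le_logSize (N : ℕ) : 1 ≤ logSize N := by
  have := harm_nonneg (2 * N)
  rw [logSize]; linarith

lemma harm_le_logSize {M N : ℕ} (h : M ≤ 2 * N) : harm M ≤ logSize N := by
  have := harm_mono h
  rw [logSize]; linarith

lemma harm_sub_mul_le {N M : ℕ} (h : M ≤ N) :
    (harm N - harm M) * N ≤ logSize N * ((N : ℝ) - M) := by
  have h1 : (harm N - harm M) * N ≤ (1 + (harm N - harm M)) * ((N : ℝ) - M) := by
    rw [harm, harm, ← Finset.sum_Ico_eq_sub _ h]
    have : ((N : ℝ) - M) = ∑ i ∈ Finset.Ico M N, (1 : ℝ) := by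
      simp [Nat.cast_sub h]
    rw [add_mul, one_mul]
    conv_rhs => rw [this, Finset.sum_mul, ← Finset.sum_add_distrib, ← this]
    rw [Finset.sum_mul]
    refine Finset.sum_le_sum fun i hi => ?_
    have hi1 : (M : ℝ) ≤ i := by exact_mod_cast (Finset.mem_Ico.1 hi).1
    have hi0 : (0 : ℝ) < (i : ℝ) + 1 := by positivity
    rw [div_mul_eq_mul_div, div_mul_eq_mul_div, one_mul, one_mul, ← sub_nonneg]
    have : 1 + ((N : ℝ) - M) / ((i : ℝ) + 1) - N / ((i : ℝ) + 1) = (i + 1 - M) / ((i : ℝ) + 1) := by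
      field_simp; ring
    rw [this]
    exact div_nonneg (by linarith) hi0.le
  refine h1.trans (mul_le_mul_of_nonneg_right ?_ (sub_nonneg.2 (by exact_mod_cast h)))
  have := harm_mono (show N ≤ 2 * N by omega)
  have := harm_nonneg M
  rw [logSize]; linarith

lemma harm_sub_mul_le' {N M : ℕ} (h : N ≤ M) :
    (harm M - harm N) * N ≤ (M : ℝ) - N := by
  induction M, h using Nat.le_induction with
  | base => simp
  | succ M hM ih =>
    rw [harm_succ]
    have : 1 / ((M : ℝ) + 1) * N ≤ 1 := by
      rw [div_mul_eq_mul_div, one_mul, div_le_one (by positivity)]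
      have : (N : ℝ) ≤ M := by exact_mod_cast hM
      linarith
    push_cast
    nlinarith

lemma abs_harm_sub_mul_le (N M : ℕ) :
    |harm M - harm N| * N ≤ logSize N * |(M : ℝ) - N| := by
  rcases le_total M N with h | h
  · have h1 := harm_mono h
    have h2 : (M : ℝ) ≤ N := by exact_mod_cast h
    rw [abs_sub_comm, abs_of_nonneg (by linarith), abs_sub_comm, abs_of_nonneg (by linarith)]
    exact harm_sub_mul_le h
  · have h1 := harm_mono h
    have h2 : (N : ℝ) ≤ M := by exact_mod_cast h
    rw [abs_of_nonneg (by linarith), abs_of_nonneg (by linarith)]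
    have := one_le_logSize N
    nlinarith [harm_sub_mul_le' h]

lemma truncated_succ (M : ℕ) (v : List ℕ) (b : ℕ) :
    truncated (M + 1) (v ++ [b]) =
      truncated M (v ++ [b]) + truncated M v * (1 / ((M : ℝ) + 1)) ^ b := by
  rw [truncated, List.range_succ, List.map_append, List.map_singleton, qs_append_singleton,
    truncated]

lemma truncated_nil (M : ℕ) : truncated M [] = 1 := qs_nil _

lemma truncated_zero (v : List ℕ) (b : ℕ) : truncated 0 (v ++ [b]) = 0 := by
  rw [truncated, List.range_zero, List.map_nil, qs]
  cases v <;> rfl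

lemma truncated_nonneg (M : ℕ) (w : List ℕ) : 0 ≤ truncated M w := by
  induction M generalizing w with
  | zero =>
    cases w with
    | nil => simp [truncated_nil]
    | cons b v => simp [truncated, qs, convOne]
  | succ M ih =>
    rcases List.eq_nil_or_concat' w with rfl | ⟨v, b, rfl⟩
    · simp [truncated_nil]
    · rw [truncated_succ]
      have := ih v
      have := ih (v ++ [b])
      positivity

lemma truncated_increment {N : ℕ} {v : List ℕ} {b : ℕ} (hb : 0 < b) {D : ℝ}
    (hD : ∀ i ≤ 2 * N, |truncated i v| ≤ D) {a c : ℕ} (hac : a ≤ c) (hc : c ≤ 2 * N) :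
    |truncated c (v ++ [b]) - truncated a (v ++ [b])| ≤ D * (harm c - harm a) := by
  induction c, hac using Nat.le_induction with
  | base => simp
  | succ c hac ih =>
    have ih := ih (by omega)
    have h1 : |truncated c v * (1 / ((c : ℝ) + 1)) ^ b| ≤ D * (1 / ((c : ℝ) + 1)) := by
      have h0 : (0 : ℝ) ≤ 1 / ((c : ℝ) + 1) := by positivity
      rw [abs_mul, abs_of_nonneg (pow_nonneg h0 b)]
      refine mul_le_mul (hD c (by omega)) ?_ (by positivity)
        ((abs_nonneg _).trans (hD c (by omega)))
      refine pow_le_of_le_one h0 ?_ hb.ne'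
      rw [div_le_one (by positivity)]
      have : (0 : ℝ) ≤ c := by positivity
      linarith
    rw [truncated_succ, harm_succ]
    calc _ = |(truncated c (v ++ [b]) - truncated a (v ++ [b])) +
          truncated c v * (1 / ((c : ℝ) + 1)) ^ b| := by congr 1; ring
      _ ≤ _ := abs_add_le _ _
      _ ≤ D * (harm c - harm a) + D * (1 / ((c : ℝ) + 1)) := add_le_add ih h1
      _ = _ := by ring

lemma truncated_bounds (w : List ℕ) (hw : ∀ i ∈ w, 0 < i) : ∃ C p, 0 ≤ C ∧
    ∀ N M : ℕ, M ≤ 2 * N → |truncated M w| ≤ C * logSize N ^ p ∧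
      |truncated M w - truncated N w| * N ≤ C * logSize N ^ p * |(M : ℝ) - N| := by
  induction w using List.reverseRecOn with
  | nil => exact ⟨1, 0, zero_le_one, fun N M _ => by simp [truncated_nil]⟩
  | append_singleton v b ih =>
    obtain ⟨C, p, hC, h⟩ := ih fun i hi => hw i (by simp [hi])
    have hb : 0 < b := hw b (by simp)
    refine ⟨C, p + 1, hC, fun N M hM => ?_⟩
    have hL := one_le_logSize N
    have hD : ∀ i ≤ 2 * N, |truncated i v| ≤ C * logSize N ^ p := fun i hi => (h N i hi).1
    have hD0 : 0 ≤ C * logSize N ^ p := by positivity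
    constructor
    · have := truncated_increment hb hD (Nat.zero_le M) hM
      rw [truncated_zero, sub_zero] at this
      refine this.trans ?_
      rw [pow_succ, ← mul_assoc]
      refine mul_le_mul_of_nonneg_left ?_ hD0
      have := harm_le_logSize hM
      simpa [harm] using this
    · have key : |truncated M (v ++ [b]) - truncated N (v ++ [b])| ≤
          C * logSize N ^ p * |harm M - harm N| := by
        rcases le_total M N with h | h
        · rw [abs_sub_comm, abs_sub_comm (harm M), abs_of_nonneg (sub_nonneg.2 (harm_mono h))]
          exact truncated_increment hb hD h (by omega)
        · rw [abs_of_nonneg (sub_nonneg.2 (harm_mono h))]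
          exact truncated_increment hb hD h hM
      calc _ ≤ C * logSize N ^ p * |harm M - harm N| * N := by gcongr
        _ = C * logSize N ^ p * (|harm M - harm N| * N) := by ring
        _ ≤ C * logSize N ^ p * (logSize N * |(M : ℝ) - N|) :=
          mul_le_mul_of_nonneg_left (abs_harm_sub_mul_le N M) hD0
        _ = _ := by ring

/-- Families bounded by powers of logarithms which are nearly Lipschitz in the offset `n / N`. -/
def LogLipschitz (φ : ℕ → ℤ → ℝ) : Prop :=
  ∃ C p, 0 ≤ C ∧ ∀ (N : ℕ) (n : ℤ), |n| ≤ N → |φ N n| ≤ C * logSize N ^ p ∧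
    |φ N n - φ N 0| * N ≤ C * logSize N ^ p * |(n : ℝ)|

lemma LogLipschitz.const (c : ℝ) : LogLipschitz fun _ _ => c :=
  ⟨|c|, 0, abs_nonneg c, fun N n _ => ⟨by simp, by simp; positivity⟩⟩

lemma LogLipschitz.add {φ ψ : ℕ → ℤ → ℝ} (hφ : LogLipschitz φ) (hψ : LogLipschitz ψ) :
    LogLipschitz fun N n => φ N n + ψ N n := by
  obtain ⟨C, p, hC, h⟩ := hφ
  obtain ⟨D, q, hD, h'⟩ := hψ
  refine ⟨C + D, p + q, add_nonneg hC hD, fun N n hn => ?_⟩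
  obtain ⟨h1, h2⟩ := h N n hn
  obtain ⟨h3, h4⟩ := h' N n hn
  have hL := one_le_logSize N
  have hp : logSize N ^ p ≤ logSize N ^ (p + q) := pow_le_pow_right₀ hL (by omega)
  have hq : logSize N ^ q ≤ logSize N ^ (p + q) := pow_le_pow_right₀ hL (by omega)
  have hCp := mul_le_mul_of_nonneg_left hp hC
  have hDq := mul_le_mul_of_nonneg_left hq hD
  constructor
  · refine (abs_add_le _ _).trans ?_
    rw [add_mul]; linarith
  · have : |φ N n + ψ N n - (φ N 0 + ψ N 0)| ≤ |φ N n - φ N 0| + |ψ N n - ψ N 0| := by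
      rw [add_sub_add_comm]; exact abs_add_le _ _
    calc _ ≤ (|φ N n - φ N 0| + |ψ N n - ψ N 0|) * N := by gcongr
      _ ≤ C * logSize N ^ p * |(n : ℝ)| + D * logSize N ^ q * |(n : ℝ)| := by
        rw [add_mul]; linarith
      _ ≤ C * logSize N ^ (p + q) * |(n : ℝ)| + D * logSize N ^ (p + q) * |(n : ℝ)| := by gcongr
      _ = _ := by ring

lemma LogLipschitz.mul {φ ψ : ℕ → ℤ → ℝ} (hφ : LogLipschitz φ) (hψ : LogLipschitz ψ) :
    LogLipschitz fun N n => φ N n * ψ N n := by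
  obtain ⟨C, p, hC, h⟩ := hφ
  obtain ⟨D, q, hD, h'⟩ := hψ
  refine ⟨2 * (C * D), p + q, by positivity, fun N n hn => ?_⟩
  obtain ⟨h1, h2⟩ := h N n hn
  obtain ⟨h3, h4⟩ := h' N n hn
  have h0 := (h N 0 (by simp)).1
  have hL := one_le_logSize N
  constructor
  · rw [abs_mul]
    calc _ ≤ (C * logSize N ^ p) * (D * logSize N ^ q) := by gcongr
      _ = (C * D) * logSize N ^ (p + q) := by rw [pow_add]; ring
      _ ≤ _ := by
        have : 0 ≤ C * D * logSize N ^ (p + q) := by positivity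
        linarith
  · have : |φ N n * ψ N n - φ N 0 * ψ N 0| ≤
        |φ N n - φ N 0| * |ψ N n| + |φ N 0| * |ψ N n - ψ N 0| := by
      rw [← abs_mul, ← abs_mul]
      refine le_trans (le_of_eq ?_) (abs_add_le _ _)
      congr 1; ring
    calc _ ≤ (|φ N n - φ N 0| * |ψ N n| + |φ N 0| * |ψ N n - ψ N 0|) * N := by gcongr
      _ = (|φ N n - φ N 0| * N) * |ψ N n| + |φ N 0| * (|ψ N n - ψ N 0| * N) := by ring
      _ ≤ (C * logSize N ^ p * |(n : ℝ)|) * (D * logSize N ^ q) +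
          (C * logSize N ^ p) * (D * logSize N ^ q * |(n : ℝ)|) := by gcongr
      _ = _ := by rw [pow_add]; ring

lemma LogLipschitz.sum {ι : Type*} (s : Finset ι) {φ : ι → ℕ → ℤ → ℝ}
    (h : ∀ i ∈ s, LogLipschitz (φ i)) : LogLipschitz fun N n => ∑ i ∈ s, φ i N n := by
  classical
  induction s using Finset.induction_on with
  | empty => simpa using LogLipschitz.const 0
  | insert a s ha ih =>
    simp only [Finset.sum_insert ha]
    exact (h a (by simp)).add (ih fun i hi => h i (by simp [hi]))

lemma LogLipschitz.truncated_add (w : List ℕ) (hw : ∀ i ∈ w, 0 < i) :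
    LogLipschitz fun N n => truncated (N + n).toNat w := by
  obtain ⟨C, p, hC, h⟩ := truncated_bounds w hw
  refine ⟨C, p, hC, fun N n hn => ?_⟩
  rw [abs_le] at hn
  have := h N (N + n).toNat (by omega)
  have e : (((N + n).toNat : ℕ) : ℝ) - N = n := by
    have : (((N + n).toNat : ℕ) : ℤ) = N + n := by omega
    have : (((N + n).toNat : ℕ) : ℝ) = N + n := by exact_mod_cast this
    rw [this]; ring
  rw [e] at this
  simpa using this

lemma LogLipschitz.truncated_sub (w : List ℕ) (hw : ∀ i ∈ w, 0 < i) :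
    LogLipschitz fun N n => truncated (N - n).toNat w := by
  obtain ⟨C, p, hC, h⟩ := LogLipschitz.truncated_add w hw
  refine ⟨C, p, hC, fun N n hn => ?_⟩
  have := h N (-n) (by rwa [abs_neg])
  simpa [← sub_eq_add_neg] using this

lemma LogLipschitz.zetaA {F : ℕ → ℤ → List ℕ → ℝ}
    (hF : ∀ w, (∀ i ∈ w, 0 < i) → LogLipschitz fun N n => F N n w) (a : ℕ) (l : List ℕ)
    (hl : ∀ i ∈ l, 0 < i) : LogLipschitz fun N n => zetaA (F N n) a l := by
  refine (LogLipschitz.const _).mul (LogLipschitz.sum _ fun f _ => ?_)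
  refine (hF _ ?_).mul (LogLipschitz.const _)
  intro i hi
  obtain ⟨j, rfl⟩ := (List.mem_ofFn' _ _).1 hi
  exact Nat.add_pos_left (hl (l.get j) (List.get_mem _ _)) _

lemma LogLipschitz.polarCoeff (k : List ℕ) (hk : ∀ i ∈ k, 0 < i) (c : ℕ) :
    LogLipschitz fun N n => polarCoeff (N + n).toNat (N - n).toNat k c := by
  have ht : ∀ j, ∀ i ∈ (k.take j).reverse, 0 < i := fun j i hi =>
    hk i (List.mem_of_mem_take (List.mem_reverse.1 hi))
  have hd : ∀ j, ∀ i ∈ k.drop j, 0 < i := fun j i hi => hk i (List.mem_of_mem_drop hi)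
  simp only [_root_.polarCoeff, coeff_tangentSeries]
  refine LogLipschitz.add ?_ (LogLipschitz.sum _ fun j _ => ?_)
  · split_ifs
    · exact LogLipschitz.sum _ fun j _ => ((LogLipschitz.const _).mul
        (LogLipschitz.truncated_add _ (ht j))).mul (LogLipschitz.truncated_sub _ (hd j))
    · exact LogLipschitz.const 0
  · split_ifs
    · exact LogLipschitz.sum _ fun a _ => ((LogLipschitz.const _).mul
        (LogLipschitz.zetaA LogLipschitz.truncated_add _ _ (ht j))).mul
          (LogLipschitz.zetaA LogLipschitz.truncated_sub _ _ (hd _))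
    · exact LogLipschitz.const 0

end Growth

section Estimate

lemma sum_Icc_erase_zero {E : Type*} [AddCommMonoid E] (f : ℤ → E) (N : ℕ) :
    ∑ n ∈ (Finset.Icc (-(N : ℤ)) N).erase 0, f n =
      ∑ i ∈ Finset.range N, (f ((i : ℤ) + 1) + f (-((i : ℤ) + 1))) := by
  induction N with
  | zero => simp
  | succ N ih =>
    have h : (Finset.Icc (-((N + 1 : ℕ) : ℤ)) ((N + 1 : ℕ) : ℤ)).erase 0 =
        insert ((N : ℤ) + 1) (insert (-((N : ℤ) + 1)) ((Finset.Icc (-(N : ℤ)) N).erase 0)) := by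
      ext n
      simp only [Finset.mem_erase, Finset.mem_Icc, Finset.mem_insert]
      push_cast
      omega
    rw [h, Finset.sum_insert, Finset.sum_insert, ih, Finset.sum_range_succ]
    · rw [← add_assoc, add_comm]
    · simp only [Finset.mem_erase, Finset.mem_Icc]
      omega
    · simp only [Finset.mem_erase, Finset.mem_Icc, Finset.mem_insert]
      omega

lemma sum_Icc_symm {E : Type*} [AddCommMonoid E] (f : ℤ → E) (N : ℕ) :
    ∑ n ∈ Finset.Icc (-(N : ℤ)) N, f n =
      f 0 + ∑ i ∈ Finset.range N, (f ((i : ℤ) + 1) + f (-((i : ℤ) + 1))) := by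
  rw [← sum_Icc_erase_zero, Finset.add_sum_erase]
  simp

lemma list_sum_eq_sum_Icc {E : Type*} [AddCommMonoid E] (f : ℤ → E) (N : ℕ) :
    ((List.range (2 * N + 1)).map fun i : ℕ => f ((i : ℤ) - N)).sum =
      ∑ n ∈ Finset.Icc (-(N : ℤ)) N, f n := by
  change ∑ i ∈ Finset.range (2 * N + 1), f ((i : ℤ) - N) = _
  refine Finset.sum_nbij' (fun i : ℕ => (i : ℤ) - N) (fun n => (n + N).toNat) ?_ ?_ ?_ ?_ ?_
  · intro i hi
    simp only [Finset.mem_range, Finset.mem_Icc] at *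
    omega
  · intro i hi
    simp only [Finset.mem_range, Finset.mem_Icc] at *
    omega
  · intro i hi
    simp
  · intro i hi
    simp only [Finset.mem_Icc] at *
    omega
  · intro i hi
    rfl

/-- Truncations of `2 ζ(2m)`. -/
noncomputable def evenZeta (N m : ℕ) : ℝ := 2 * ∑ i ∈ Finset.range N, 1 / ((i : ℝ) + 1) ^ (2 * m)

lemma sum_even (F : ℕ → ℝ) (hodd : ∀ c, Odd c → F c = 0) (C : ℕ) :
    ∑ c ∈ Finset.Icc 1 (2 * C), F c = ∑ m ∈ Finset.Icc 1 C, F (2 * m) := by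
  induction C with
  | zero => simp
  | succ C ih =>
    rw [show 2 * (C + 1) = 2 * C + 1 + 1 by ring, Finset.sum_Icc_succ_top (by omega),
      Finset.sum_Icc_succ_top (by omega), Finset.sum_Icc_succ_top (by omega), ih,
      hodd (2 * C + 1) ⟨C, rfl⟩, add_zero]
    rfl

lemma polarCoeff_eq_zero (p q : ℕ) (k : List ℕ) {c : ℕ} (hc : k.sum < c) :
    polarCoeff p q k c = 0 := by
  rw [polarCoeff, coeff_tangentSeries, if_neg (by omega), zero_add]
  refine Finset.sum_eq_zero fun j _ => if_neg ?_
  have := getD_le_sum k j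
  omega

lemma defect_eq_polarCoeff (N : ℕ) (k : List ℕ) :
    defect (truncated N) (evenZeta N) k = polarCoeff N N k 0 -
      ∑ c ∈ Finset.Icc 1 k.sum, polarCoeff N N k c *
        ∑ n ∈ (Finset.Icc (-(N : ℤ)) N).erase 0, (1 / (n : ℝ)) ^ c := by
  have h1 : ∑ c ∈ Finset.Icc 1 k.sum, polarCoeff N N k c *
        ∑ n ∈ (Finset.Icc (-(N : ℤ)) N).erase 0, (1 / (n : ℝ)) ^ c =
      ∑ m ∈ Finset.Icc 1 k.sum, evenZeta N m * polarCoeff N N k (2 * m) := by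
    rw [Finset.sum_subset (Finset.Icc_subset_Icc_right (show k.sum ≤ 2 * k.sum by omega)),
      sum_even]
    · refine Finset.sum_congr rfl fun m _ => ?_
      rw [mul_comm, sum_Icc_erase_zero, evenZeta, Finset.mul_sum]
      congr 1
      refine Finset.sum_congr rfl fun i _ => ?_
      push_cast
      rw [one_div_neg_eq_neg_one_div, Even.neg_pow (even_two_mul m), ← two_mul, one_div_pow]
    · intro c hc
      rw [sum_Icc_erase_zero, Finset.sum_eq_zero, mul_zero]
      intro i _
      push_cast
      rw [one_div_neg_eq_neg_one_div, hc.neg_pow, add_neg_cancel]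
    · intro c hc hc'
      simp only [Finset.mem_Icc, not_and, not_le] at hc hc'
      rw [polarCoeff_eq_zero _ _ _ (hc' hc.1), zero_mul]
  rw [defect_eq _ _ _ _ le_rfl, h1]
  rfl

lemma defect_sub_multitangent (N : ℕ) {z : ℂ} (hz : ∀ m : ℤ, z + m ≠ 0) (k : List ℕ)
    (hk0 : k ≠ []) (hk : ∀ i ∈ k, 0 < i) :
    (defect (truncated N) (evenZeta N) k : ℂ) - multitangent N z k =
      (∑ n ∈ (Finset.Icc (-(N : ℤ)) N).erase 0, ∑ c ∈ Finset.Icc 1 k.sum,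
        ((polarCoeff (N + n).toNat (N - n).toNat k c - polarCoeff N N k c : ℝ) : ℂ) *
          ((1 / (n : ℂ)) ^ c - (1 / (z + n)) ^ c)) -
      ∑ c ∈ Finset.Icc 1 k.sum, (polarCoeff N N k c : ℂ) *
        ∑ n ∈ Finset.Icc (-(N : ℤ)) N, (1 / (z + n)) ^ c := by
  obtain ⟨h1, h2⟩ := multitangent_expansion N hz k hk0 hk
  have h0 : (0 : ℤ) ∈ Finset.Icc (-(N : ℤ)) N := by simp
  rw [defect_eq_polarCoeff, h1, h2, ← Finset.add_sum_erase _ _ h0]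
  have e1 : ∀ g : ℤ → ℕ → ℂ, ∑ c ∈ Finset.Icc 1 k.sum, (polarCoeff N N k c : ℂ) *
      ∑ n ∈ (Finset.Icc (-(N : ℤ)) N).erase 0, g n c =
      ∑ n ∈ (Finset.Icc (-(N : ℤ)) N).erase 0, ∑ c ∈ Finset.Icc 1 k.sum,
        (polarCoeff N N k c : ℂ) * g n c := by
    intro g
    simp only [Finset.mul_sum]
    exact Finset.sum_comm
  have e2 : ∑ c ∈ Finset.Icc 1 k.sum, (polarCoeff N N k c : ℂ) *
      ∑ n ∈ Finset.Icc (-(N : ℤ)) N, (1 / (z + n)) ^ c =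
      ∑ c ∈ Finset.Icc 1 k.sum, (polarCoeff N N k c : ℂ) * (1 / (z + (0 : ℤ))) ^ c +
      ∑ n ∈ (Finset.Icc (-(N : ℤ)) N).erase 0, ∑ c ∈ Finset.Icc 1 k.sum,
        (polarCoeff N N k c : ℂ) * (1 / (z + n)) ^ c := by
    rw [← e1, ← Finset.sum_add_distrib]
    refine Finset.sum_congr rfl fun c _ => ?_
    rw [← Finset.add_sum_erase _ _ h0, mul_add]
  rw [e2]
  push_cast
  rw [e1 fun n c => (1 / (n : ℂ)) ^ c]
  simp only [add_zero, sub_zero, Int.toNat_natCast, mul_sub, sub_mul, Finset.sum_sub_distrib]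
  ring

lemma norm_pow_sub_pow_le_of_le_one {a b : ℂ} (ha : ‖a‖ ≤ 1) (hb : ‖b‖ ≤ 1) (c : ℕ) :
    ‖a ^ c - b ^ c‖ ≤ c * ‖a - b‖ := by
  induction c with
  | zero => simp
  | succ c ih =>
    have e : a ^ (c + 1) - b ^ (c + 1) = (a ^ c - b ^ c) * a + b ^ c * (a - b) := by ring
    have h1 : ‖b ^ c‖ ≤ 1 := by rw [norm_pow]; exact pow_le_one₀ (norm_nonneg _) hb
    rw [e]
    refine (norm_add_le _ _).trans ?_
    rw [norm_mul, norm_mul]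
    push_cast
    nlinarith [norm_nonneg (a ^ c - b ^ c), norm_nonneg (a - b)]

lemma norm_sq_I_mul_add (y : ℝ) (n : ℝ) : ‖Complex.I * y + n‖ ^ 2 = y ^ 2 + n ^ 2 := by
  rw [Complex.sq_norm, Complex.normSq_apply]
  simp
  ring

lemma I_mul_add_ne_zero {y : ℝ} (hy : 0 < y) (n : ℝ) : Complex.I * y + n ≠ 0 := by
  intro h
  have := norm_sq_I_mul_add y n
  rw [h, norm_zero] at this
  nlinarith [sq_nonneg n]

lemma norm_one_div_sq (y n : ℝ) : ‖1 / (Complex.I * y + n)‖ ^ 2 = 1 / (y ^ 2 + n ^ 2) := by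
  rw [norm_div, norm_one, div_pow, one_pow, norm_sq_I_mul_add]

lemma norm_one_div_le_one {y : ℝ} (hy : 1 ≤ y) (n : ℝ) : ‖1 / (Complex.I * y + n)‖ ≤ 1 := by
  have h := norm_one_div_sq y n
  have h1 : 1 / (y ^ 2 + n ^ 2) ≤ 1 := by
    rw [div_le_one (by positivity)]
    nlinarith [sq_nonneg n]
  nlinarith [norm_nonneg (1 / (Complex.I * y + n))]

lemma norm_one_div_le {y n : ℝ} (hn : n ≠ 0) :
    ‖1 / (Complex.I * y + n)‖ ≤ 1 / |n| := by
  rw [norm_div, norm_one]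
  refine one_div_le_one_div_of_le (abs_pos.2 hn) ?_
  exact abs_le_of_sq_le_sq (by rw [norm_sq_I_mul_add]; nlinarith) (norm_nonneg _)

lemma norm_one_div_pow_sub_le {y : ℝ} (hy : 0 < y) {n : ℤ} (hn : n ≠ 0) (c : ℕ) :
    ‖(1 / (n : ℂ)) ^ c - (1 / (Complex.I * y + n)) ^ c‖ ≤ c * (y / (n : ℝ) ^ 2) := by
  have hn' : (n : ℝ) ≠ 0 := by exact_mod_cast hn
  have hn1 : (1 : ℝ) ≤ |(n : ℝ)| := by exact_mod_cast Int.one_le_abs hn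
  have hle := norm_one_div_le (y := y) hn'
  have hle1 : 1 / |(n : ℝ)| ≤ 1 := by rw [div_le_one (by positivity)]; exact hn1
  have hz := I_mul_add_ne_zero hy (n : ℝ)
  rw [Complex.ofReal_intCast] at hle hz
  have ha : ‖1 / (n : ℂ)‖ = 1 / |(n : ℝ)| := by
    rw [norm_div, norm_one, Complex.norm_intCast]
  refine (norm_pow_sub_pow_le_of_le_one (ha.le.trans hle1) (hle.trans hle1) c).trans ?_
  refine mul_le_mul_of_nonneg_left ?_ (Nat.cast_nonneg c)
  have hnC : (n : ℂ) ≠ 0 := by exact_mod_cast hn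
  have e : 1 / (n : ℂ) - 1 / (Complex.I * y + n) =
      (1 / (n : ℂ)) * (1 / (Complex.I * y + n)) * (Complex.I * y) := by
    field_simp
    ring
  rw [e, norm_mul, norm_mul, ha]
  have hy' : ‖Complex.I * (y : ℂ)‖ = y := by simp [abs_of_pos hy]
  rw [hy']
  calc _ ≤ 1 / |(n : ℝ)| * (1 / |(n : ℝ)|) * y := by gcongr
    _ = y / |(n : ℝ)| ^ 2 := by field_simp
    _ = _ := by rw [sq_abs]

lemma sum_norm_sq_le {y : ℝ} (hy : 1 ≤ y) (N : ℕ) :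
    ∑ n ∈ Finset.Icc (-(N : ℤ)) N, ‖1 / (Complex.I * y + n)‖ ^ 2 ≤ logSize N / y := by
  have h : ∀ n : ℤ, ‖1 / (Complex.I * y + n)‖ ^ 2 = 1 / (y ^ 2 + (n : ℝ) ^ 2) := fun n => by
    rw [← norm_one_div_sq, Complex.ofReal_intCast]
  have hN := harm_mono (show N ≤ 2 * N by omega)
  simp only [h]
  rw [sum_Icc_symm]
  have h1 : 1 / (y ^ 2 + ((0 : ℤ) : ℝ) ^ 2) ≤ 1 / y := by
    refine one_div_le_one_div_of_le (by positivity) ?_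
    push_cast
    nlinarith
  have h2 : ∑ i ∈ Finset.range N, (1 / (y ^ 2 + (((i : ℤ) + 1 : ℤ) : ℝ) ^ 2) +
      1 / (y ^ 2 + ((-((i : ℤ) + 1) : ℤ) : ℝ) ^ 2)) ≤ harm N / y := by
    rw [harm, Finset.sum_div]
    refine Finset.sum_le_sum fun i _ => ?_
    push_cast
    rw [neg_sq, ← two_mul, mul_one_div, div_div, div_le_div_iff₀ (by positivity) (by positivity)]
    nlinarith [sq_nonneg (y - ((i : ℝ) + 1))]
  calc _ ≤ 1 / y + harm N / y := add_le_add h1 h2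
    _ = (1 + harm N) / y := by ring
    _ ≤ _ := by
      rw [logSize]
      gcongr

lemma sum_one_div_eq {y : ℝ} (hy : 0 < y) (N : ℕ) :
    ∑ n ∈ Finset.Icc (-(N : ℤ)) N, 1 / (Complex.I * y + n) =
      -Complex.I * ((1 / y + ∑ i ∈ Finset.range N, 2 * (y / (y ^ 2 + ((i : ℝ) + 1) ^ 2)) : ℝ) : ℂ) := by
  rw [sum_Icc_symm]
  push_cast
  rw [mul_add, Finset.mul_sum]
  have hyC : (y : ℂ) ≠ 0 := by exact_mod_cast hy.ne'
  congr 1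
  · rw [add_zero, one_div, mul_inv, Complex.inv_I]
    ring
  · refine Finset.sum_congr rfl fun i _ => ?_
    have h1 := I_mul_add_ne_zero hy ((i : ℝ) + 1)
    have h2 := I_mul_add_ne_zero hy (-((i : ℝ) + 1))
    have h3 : ((y : ℂ) ^ 2 + ((i : ℂ) + 1) ^ 2) ≠ 0 := by
      have : y ^ 2 + ((i : ℝ) + 1) ^ 2 ≠ 0 := by positivity
      exact_mod_cast this
    push_cast at h1 h2
    rw [div_add_div _ _ h1 h2, mul_div_assoc', mul_div_assoc', div_eq_div_iff (mul_ne_zero h1 h2) h3]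
    ring_nf
    simp only [show Complex.I ^ 3 = -Complex.I by rw [pow_succ, Complex.I_sq]; ring]
    ring

lemma abs_defect_sub_re_le (k : List ℕ) (hk0 : k ≠ []) (hk : ∀ i ∈ k, 0 < i) :
    ∃ C p, ∀ y : ℕ, 1 ≤ y →
      |defect (truncated (y ^ 2)) (evenZeta (y ^ 2)) k -
        (multitangent (y ^ 2) (Complex.I * (y : ℝ)) k).re| ≤ C * logSize (y ^ 2) ^ p / y := by
  have hc : ∀ c, ∃ C : ℝ, ∃ p : ℕ, 0 ≤ C ∧ ∀ (N : ℕ), 1 ≤ N →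
      |polarCoeff N N k c| ≤ C * logSize N ^ p ∧ ∀ n : ℤ, |n| ≤ N →
      |polarCoeff (N + n).toNat (N - n).toNat k c - polarCoeff N N k c| ≤
        C * logSize N ^ p * |(n : ℝ)| / N := by
    intro c
    obtain ⟨C, p, hC, h⟩ := LogLipschitz.polarCoeff k hk c
    refine ⟨C, p, hC, fun N hN => ⟨?_, fun n hn => ?_⟩⟩
    · have := (h N 0 (by simp)).1
      simpa using this
    · have := (h N n hn).2
      rw [le_div_iff₀ (by exact_mod_cast hN)]
      simpa using this
  choose C p hC hκ using hc
  refine ⟨∑ c ∈ Finset.Icc 1 k.sum, (2 * c + 1) * C c,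
    (∑ c ∈ Finset.Icc 1 k.sum, p c) + 1, fun y hy => ?_⟩
  set N := y ^ 2 with hN
  have hN1 : 1 ≤ N := Nat.one_le_pow _ _ hy
  have hy1 : (1 : ℝ) ≤ (y : ℝ) := by exact_mod_cast hy
  have hy0 : (0 : ℝ) < (y : ℝ) := by linarith
  have hL := one_le_logSize N
  have hz : ∀ m : ℤ, Complex.I * ((y : ℝ) : ℂ) + m ≠ 0 := fun m => by
    have := I_mul_add_ne_zero hy0 (m : ℝ)
    rwa [Complex.ofReal_intCast] at this
  have key := congrArg Complex.re (defect_sub_multitangent N hz k hk0 hk)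
  rw [Complex.sub_re, Complex.ofReal_re] at key
  rw [key, Finset.sum_comm, ← Finset.sum_sub_distrib, Complex.re_sum]
  refine (Finset.abs_sum_le_sum_abs _ _).trans ?_
  rw [Finset.sum_mul, Finset.sum_div]
  refine Finset.sum_le_sum fun c hc => ?_
  have hc1 : 1 ≤ c := (Finset.mem_Icc.1 hc).1
  have hpc : p c ≤ ∑ c ∈ Finset.Icc 1 k.sum, p c :=
    Finset.single_le_sum (fun _ _ => Nat.zero_le _) hc
  have hpow : logSize N ^ (p c) * logSize N ≤
      logSize N ^ ((∑ c ∈ Finset.Icc 1 k.sum, p c) + 1) := by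
    rw [← pow_succ]
    exact pow_le_pow_right₀ hL (by omega)
  obtain ⟨hb, hl⟩ := hκ c N hN1
  have hB0 : 0 ≤ C c * logSize N ^ p c := by have := hC c; positivity
  have hA : ‖∑ n ∈ (Finset.Icc (-(N : ℤ)) N).erase 0,
      ((polarCoeff (N + n).toNat (N - n).toNat k c - polarCoeff N N k c : ℝ) : ℂ) *
          ((1 / (n : ℂ)) ^ c - (1 / (Complex.I * ((y : ℝ) : ℂ) + n)) ^ c)‖ ≤
      2 * c * (C c * logSize N ^ p c * logSize N / y) := by
    have h1 : ∀ n ∈ (Finset.Icc (-(N : ℤ)) N).erase 0,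
        ‖((polarCoeff (N + n).toNat (N - n).toNat k c - polarCoeff N N k c : ℝ) : ℂ) *
          ((1 / (n : ℂ)) ^ c - (1 / (Complex.I * ((y : ℝ) : ℂ) + n)) ^ c)‖ ≤
        c * (C c * logSize N ^ p c / y) * (1 / |(n : ℝ)|) := by
      intro n hn
      rw [Finset.mem_erase, Finset.mem_Icc] at hn
      have hn0 : 0 < |(n : ℝ)| := abs_pos.2 (by exact_mod_cast hn.1)
      rw [norm_mul, Complex.norm_real, Real.norm_eq_abs]
      calc _ ≤ (C c * logSize N ^ p c * |(n : ℝ)| / N) * (c * (y / (n : ℝ) ^ 2)) :=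
            mul_le_mul (hl n (abs_le.2 hn.2)) (norm_one_div_pow_sub_le hy0 hn.1 c)
              (norm_nonneg _) (by positivity)
        _ = _ := by
          rw [hN, ← sq_abs (n : ℝ)]
          push_cast
          field_simp
    refine (norm_sum_le_of_le _ h1).trans ?_
    rw [← Finset.mul_sum]
    have h2 : ∑ n ∈ (Finset.Icc (-(N : ℤ)) N).erase 0, 1 / |(n : ℝ)| = 2 * harm N := by
      rw [sum_Icc_erase_zero, harm, Finset.mul_sum]
      refine Finset.sum_congr rfl fun i _ => ?_
      push_cast
      rw [abs_neg, abs_of_pos (by positivity), two_mul]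
    rw [h2]
    have h3 := harm_le_logSize (show N ≤ 2 * N by omega)
    calc _ ≤ c * (C c * logSize N ^ p c / y) * (2 * logSize N) := by gcongr
      _ = _ := by ring
  have hB : |((polarCoeff N N k c : ℂ) *
      ∑ n ∈ Finset.Icc (-(N : ℤ)) N, (1 / (Complex.I * ((y : ℝ) : ℂ) + n)) ^ c).re| ≤
      C c * logSize N ^ p c * logSize N / y := by
    rw [Complex.re_ofReal_mul, abs_mul, mul_div_assoc]
    refine mul_le_mul hb ?_ (abs_nonneg _) hB0
    rcases eq_or_lt_of_le hc1 with rfl | hc2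
    · simp only [pow_one]
      rw [sum_one_div_eq hy0, neg_mul, Complex.neg_re, Complex.I_mul_re, Complex.ofReal_im]
      simp only [neg_zero, abs_zero]
      positivity
    · refine (Complex.abs_re_le_norm _).trans ((norm_sum_le _ _).trans
        ((Finset.sum_le_sum fun n _ => ?_).trans (sum_norm_sq_le hy1 N)))
      rw [norm_pow]
      have := norm_one_div_le_one hy1 (n : ℝ)
      rw [Complex.ofReal_intCast] at this
      exact pow_le_pow_of_le_one (norm_nonneg _) this hc2
  rw [Complex.sub_re]
  refine (abs_sub _ _).trans ?_
  have hA' := (Complex.abs_re_le_norm _).trans hA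
  refine (add_le_add hA' hB).trans ?_
  calc _ = (2 * c + 1) * C c * (logSize N ^ p c * logSize N) / y := by ring
    _ ≤ _ := by
      have := hC c
      gcongr

end Estimate

section Multitangent

open Filter Asymptotics

lemma norm_qs_le (xs : List ℂ) (k : List ℕ) :
    ‖qs xs k‖ ≤ (k.map fun b => (xs.map fun x => ‖x‖ ^ b).sum).prod := by
  induction xs generalizing k with
  | nil => cases k <;> simp [qs, convOne]
  | cons x xs ih =>
    have hs : ∀ b, 0 ≤ (xs.map fun x => ‖x‖ ^ b).sum := fun b =>
      List.sum_nonneg (by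
        intro a ha
        obtain ⟨x, _, rfl⟩ := List.mem_map.1 ha
        positivity)
    cases k with
    | nil => simp
    | cons b v =>
      rw [qs_cons_cons]
      refine (norm_add_le _ _).trans ?_
      have h1 := ih (b :: v)
      have h2 := ih v
      rw [norm_mul, norm_pow]
      simp only [List.map_cons, List.prod_cons, List.sum_cons] at h1 ⊢
      have h3 : (v.map fun b => (xs.map fun x => ‖x‖ ^ b).sum).prod ≤
          (v.map fun b => ‖x‖ ^ b + (xs.map fun x => ‖x‖ ^ b).sum).prod := by
        clear h1 h2
        induction v with
        | nil => simp
        | cons c v ihv =>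
          simp only [List.map_cons, List.prod_cons]
          refine mul_le_mul ?_ ihv ?_ ?_
          · have : 0 ≤ ‖x‖ ^ c := by positivity
            linarith
          · refine List.prod_nonneg ?_
            intro a ha
            obtain ⟨b, _, rfl⟩ := List.mem_map.1 ha
            exact hs b
          · have : 0 ≤ ‖x‖ ^ c := by positivity
            linarith [hs c]
      have h4 : 0 ≤ ‖x‖ ^ b := by positivity
      rw [add_mul]
      have h5 := mul_le_mul_of_nonneg_left (h2.trans h3) h4
      have h6 := mul_le_mul_of_nonneg_left h3 (hs b)
      linarith

lemma prod_le_of_exists_small {f : ℕ → ℝ} {B ε : ℝ} (hB : 1 ≤ B) (k : List ℕ)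
    (h0 : ∀ b ∈ k, 0 ≤ f b) (h1 : ∀ b ∈ k, f b ≤ B) :
    (k.map f).prod ≤ B ^ k.length ∧
      ((∃ b ∈ k, f b ≤ ε) → 0 ≤ ε → (k.map f).prod ≤ B ^ k.length * ε) := by
  induction k with
  | nil => simp
  | cons a k ih =>
    obtain ⟨ih1, ih2⟩ := ih (fun b hb => h0 b (by simp [hb])) fun b hb => h1 b (by simp [hb])
    have ha0 := h0 a (by simp)
    have ha1 := h1 a (by simp)
    have hp : 0 ≤ (k.map f).prod := List.prod_nonneg (by
      intro x hx
      obtain ⟨b, hb, rfl⟩ := List.mem_map.1 hx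
      exact h0 b (by simp [hb]))
    have hB0 : 0 ≤ B := by linarith
    have hBk : 0 ≤ B ^ k.length := by positivity
    simp only [List.map_cons, List.prod_cons, List.length_cons, pow_succ']
    refine ⟨mul_le_mul ha1 ih1 hp hB0, ?_⟩
    rintro ⟨b, hb, hbε⟩ hε
    rcases List.mem_cons.1 hb with rfl | hb
    · calc _ ≤ ε * B ^ k.length := mul_le_mul hbε ih1 hp hε
        _ ≤ B * (ε * B ^ k.length) := le_mul_of_one_le_left (by positivity) hB
        _ = _ := by ring
    · calc _ ≤ B * (B ^ k.length * ε) := mul_le_mul ha1 (ih2 ⟨b, hb, hbε⟩ hε) hp hB0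
        _ = _ := by ring

lemma multitangent_sum_norm (N : ℕ) (z : ℂ) (b : ℕ) :
    (((List.range (2 * N + 1)).map fun i : ℕ => 1 / (z + ((i : ℤ) - N : ℤ))).map
      fun x => ‖x‖ ^ b).sum = ∑ n ∈ Finset.Icc (-(N : ℤ)) N, ‖1 / (z + n)‖ ^ b := by
  rw [← list_sum_eq_sum_Icc (fun n : ℤ => ‖1 / (z + n)‖ ^ b), List.map_map]
  rfl

lemma sum_norm_pow_le {y : ℝ} (hy : 1 ≤ y) (N : ℕ) {b : ℕ} (hb : 0 < b) :
    ∑ n ∈ Finset.Icc (-(N : ℤ)) N, ‖1 / (Complex.I * y + n)‖ ^ b ≤ 2 * logSize N ∧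
      (2 ≤ b → ∑ n ∈ Finset.Icc (-(N : ℤ)) N, ‖1 / (Complex.I * y + n)‖ ^ b ≤ logSize N / y) := by
  have h1 : ∀ n : ℤ, ‖1 / (Complex.I * y + n)‖ ≤ 1 := fun n => by
    have := norm_one_div_le_one hy (n : ℝ)
    rwa [Complex.ofReal_intCast] at this
  have hy0 : 0 < y := by linarith
  constructor
  · have h2 : ∀ n : ℤ, n ≠ 0 → ‖1 / (Complex.I * y + n)‖ ≤ 1 / |(n : ℝ)| := fun n hn => by
      have := norm_one_div_le (y := y) (n := n) (by exact_mod_cast hn)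
      rwa [Complex.ofReal_intCast] at this
    refine (Finset.sum_le_sum (g := fun n : ℤ => ‖1 / (Complex.I * y + n)‖) fun n _ =>
      pow_le_of_le_one (norm_nonneg _) (h1 n) hb.ne').trans ?_
    rw [sum_Icc_symm]
    have h3 : ∑ i ∈ Finset.range N, (‖1 / (Complex.I * y + ((i : ℤ) + 1 : ℤ))‖ +
        ‖1 / (Complex.I * y + (-((i : ℤ) + 1) : ℤ))‖) ≤ 2 * harm N := by
      rw [harm, Finset.mul_sum]
      refine Finset.sum_le_sum fun i _ => ?_
      have h4 := h2 ((i : ℤ) + 1) (by omega)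
      have h5 := h2 (-((i : ℤ) + 1)) (by omega)
      have h6 : |(((i : ℤ) + 1 : ℤ) : ℝ)| = (i : ℝ) + 1 := by
        push_cast
        exact abs_of_pos (by positivity)
      have h7 : |((-((i : ℤ) + 1) : ℤ) : ℝ)| = (i : ℝ) + 1 := by
        rw [Int.cast_neg, abs_neg, h6]
      rw [h6] at h4
      rw [h7] at h5
      linarith
    have h8 := harm_mono (show N ≤ 2 * N by omega)
    have h9 := h1 0
    rw [logSize]
    linarith [harm_nonneg N]
  · intro hb2
    exact (Finset.sum_le_sum fun n _ => pow_le_pow_of_le_one (norm_nonneg _) (h1 n) hb2).trans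
      (sum_norm_sq_le hy N)

lemma norm_multitangent_le {y : ℝ} (hy : 1 ≤ y) (N : ℕ) (k : List ℕ) (hk : ∀ i ∈ k, 0 < i) :
    ‖multitangent N (Complex.I * y) k‖ ≤ (2 * logSize N) ^ k.length ∧
    ((∃ b ∈ k, 2 ≤ b) →
      ‖multitangent N (Complex.I * y) k‖ ≤ (2 * logSize N) ^ k.length * (logSize N / y)) := by
  have h := norm_qs_le ((List.range (2 * N + 1)).map fun i : ℕ =>
    1 / (Complex.I * y + ((i : ℤ) - N : ℤ))) k
  simp only [multitangent_sum_norm] at h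
  have hL := one_le_logSize N
  have h0 : ∀ b ∈ k, 0 ≤ ∑ n ∈ Finset.Icc (-(N : ℤ)) N, ‖1 / (Complex.I * y + n)‖ ^ b :=
    fun b _ => Finset.sum_nonneg fun _ _ => by positivity
  obtain ⟨h1, h2⟩ := prod_le_of_exists_small (ε := logSize N / y)
    (show 1 ≤ 2 * logSize N by linarith) k h0 fun b hb => (sum_norm_pow_le hy N (hk b hb)).1
  refine ⟨h.trans h1, ?_⟩
  rintro ⟨b, hb, hb2⟩
  refine h.trans (h2 ⟨b, hb, ?_⟩ (by positivity))
  exact (sum_norm_pow_le hy N (hk b hb)).2 hb2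

lemma arctan_sub_bounds {a b : ℝ} (ha : 0 ≤ a) (hab : a < b) :
    (b - a) / (1 + b ^ 2) ≤ arctan b - arctan a ∧
      arctan b - arctan a ≤ (b - a) / (1 + a ^ 2) := by
  obtain ⟨c, hc, h⟩ := exists_hasDerivAt_eq_slope arctan (fun x => 1 / (1 + x ^ 2)) hab
    continuous_arctan.continuousOn fun x _ => hasDerivAt_arctan x
  have hba : 0 < b - a := sub_pos.2 hab
  have e : arctan b - arctan a = (b - a) / (1 + c ^ 2) := by
    rw [eq_div_iff hba.ne'] at h
    rw [← h]; ring
  rw [e]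
  have h1 : a ^ 2 ≤ c ^ 2 := pow_le_pow_left₀ ha hc.1.le 2
  have h2 : c ^ 2 ≤ b ^ 2 := pow_le_pow_left₀ (ha.trans hc.1.le) hc.2.le 2
  constructor <;> gcongr

lemma sum_arctan_bounds {y : ℝ} (hy : 0 < y) (N : ℕ) :
    |∑ i ∈ Finset.range N, y / (y ^ 2 + ((i : ℝ) + 1) ^ 2) - arctan (N / y)| ≤ 1 / y := by
  have hb : ∀ i : ℕ, y / (y ^ 2 + ((i : ℝ) + 1) ^ 2) ≤ arctan ((i + 1 : ℕ) / y) - arctan (i / y) ∧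
      arctan ((i + 1 : ℕ) / y) - arctan (i / y) ≤ y / (y ^ 2 + (i : ℝ) ^ 2) := by
    intro i
    have h := arctan_sub_bounds (a := i / y) (b := (i + 1 : ℕ) / y) (by positivity)
      (by gcongr; exact_mod_cast Nat.lt_succ_self i)
    have e : ∀ t : ℝ, (((i + 1 : ℕ) : ℝ) / y - i / y) / (1 + (t / y) ^ 2) =
        y / (y ^ 2 + t ^ 2) := by
      intro t
      push_cast
      field_simp
      ring
    rw [e, e] at h
    push_cast at h ⊢
    exact h
  have htel : ∑ i ∈ Finset.range N, (arctan ((i + 1 : ℕ) / y) - arctan (i / y)) =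
      arctan (N / y) := by
    rw [Finset.sum_range_sub (fun i : ℕ => arctan (i / y))]
    simp
  have h1 : ∑ i ∈ Finset.range N, y / (y ^ 2 + ((i : ℝ) + 1) ^ 2) ≤ arctan (N / y) := by
    rw [← htel]
    exact Finset.sum_le_sum fun i _ => (hb i).1
  have h2 : arctan (N / y) ≤ 1 / y + ∑ i ∈ Finset.range N, y / (y ^ 2 + ((i : ℝ) + 1) ^ 2) := by
    rw [← htel]
    refine (Finset.sum_le_sum fun i _ => (hb i).2).trans ?_
    refine (Finset.sum_le_sum_of_subset_of_nonneg (Finset.range_mono N.le_succ)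
      fun _ _ _ => by positivity).trans ?_
    rw [Finset.sum_range_succ' _ N]
    push_cast
    rw [add_comm]
    refine add_le_add (le_of_eq ?_) le_rfl
    rw [zero_pow two_ne_zero, add_zero, sq, div_mul_cancel_left₀ hy.ne', one_div]
  rw [abs_le]
  constructor <;> [linarith; linarith [one_div_pos.2 hy]]

lemma multitangent_one_sub_le {y : ℕ} (hy : 1 ≤ y) :
    ‖((List.range (2 * y ^ 2 + 1)).map fun i : ℕ =>
      1 / (Complex.I * (y : ℝ) + ((i : ℤ) - (y ^ 2 : ℕ) : ℤ))).sum + Complex.I * π‖ ≤ 5 / y := by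
  have hy0 : (0 : ℝ) < y := by exact_mod_cast hy
  rw [list_sum_eq_sum_Icc (fun n : ℤ => 1 / (Complex.I * (y : ℝ) + n)), sum_one_div_eq hy0,
    ← Finset.mul_sum]
  have h1 := sum_arctan_bounds hy0 (y ^ 2)
  set s := ∑ i ∈ Finset.range (y ^ 2), (y : ℝ) / ((y : ℝ) ^ 2 + ((i : ℝ) + 1) ^ 2)
  have e : -Complex.I * ((1 / (y : ℝ) + 2 * s : ℝ) : ℂ) + Complex.I * π =
      -Complex.I * ((1 / (y : ℝ) + 2 * s - π : ℝ) : ℂ) := by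
    push_cast; ring
  rw [e, norm_mul, norm_neg, Complex.norm_I, one_mul, Complex.norm_real, Real.norm_eq_abs]
  have e2 : (((y ^ 2 : ℕ) : ℝ)) / y = ((y : ℝ)⁻¹)⁻¹ := by
    push_cast; field_simp
  rw [e2, arctan_inv_of_pos (by positivity)] at h1
  have h2 : 0 ≤ arctan ((y : ℝ)⁻¹) := arctan_nonneg.2 (by positivity)
  have h3 : arctan ((y : ℝ)⁻¹) ≤ 1 / y := by
    have := (arctan_sub_bounds le_rfl (inv_pos.2 hy0)).2
    simpa using this
  rw [abs_le] at h1 ⊢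
  have : (5 : ℝ) / y = 5 * (1 / y) := by ring
  rw [this]
  constructor <;> linarith

end Multitangent

section Negligible

open Filter Asymptotics

variable {E : Type*} [NormedAddCommGroup E]

/-- Sequences bounded by a power of a logarithm. -/
def Moderate (e : ℕ → E) : Prop := ∃ p : ℕ, e =O[atTop] fun y : ℕ => logSize (y ^ 2) ^ p

/-- Sequences which are `O(1 / y)` up to a power of a logarithm. -/
def Negligible (e : ℕ → E) : Prop := ∃ p : ℕ, e =O[atTop] fun y : ℕ => logSize (y ^ 2) ^ p / (y : ℝ)

lemma logSize_pow_isBigO {p q : ℕ} (h : p ≤ q) :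
    (fun y : ℕ => logSize (y ^ 2) ^ p) =O[atTop] fun y : ℕ => logSize (y ^ 2) ^ q := by
  refine IsBigO.of_bound 1 (Eventually.of_forall fun y => ?_)
  have hL := one_le_logSize (y ^ 2)
  rw [one_mul, norm_of_nonneg (by positivity), norm_of_nonneg (by positivity)]
  exact pow_le_pow_right₀ hL h

lemma logSize_pow_div_isBigO {p q : ℕ} (h : p ≤ q) :
    (fun y : ℕ => logSize (y ^ 2) ^ p / (y : ℝ)) =O[atTop]
      fun y : ℕ => logSize (y ^ 2) ^ q / (y : ℝ) := by
  simpa only [div_eq_mul_inv] using (logSize_pow_isBigO h).mul (isBigO_refl _ _)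

lemma Negligible.add {e f : ℕ → E} (he : Negligible e) (hf : Negligible f) :
    Negligible fun y => e y + f y := by
  obtain ⟨p, hp⟩ := he
  obtain ⟨q, hq⟩ := hf
  exact ⟨p + q, (hp.trans (logSize_pow_div_isBigO (Nat.le_add_right p q))).add
    (hq.trans (logSize_pow_div_isBigO (Nat.le_add_left q p)))⟩

lemma Negligible.of_bound {e : ℕ → E} {C : ℝ} {p : ℕ}
    (h : ∀ y : ℕ, 1 ≤ y → ‖e y‖ ≤ C * (logSize (y ^ 2) ^ p / y)) : Negligible e := by
  refine ⟨p, IsBigO.of_bound C ?_⟩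
  filter_upwards [eventually_ge_atTop 1] with y hy
  have hL := one_le_logSize (y ^ 2)
  rw [norm_of_nonneg (by positivity)]
  exact h y hy

lemma Moderate.of_bound {e : ℕ → E} {C : ℝ} {p : ℕ}
    (h : ∀ y : ℕ, 1 ≤ y → ‖e y‖ ≤ C * logSize (y ^ 2) ^ p) : Moderate e := by
  refine ⟨p, IsBigO.of_bound C ?_⟩
  filter_upwards [eventually_ge_atTop 1] with y hy
  have hL := one_le_logSize (y ^ 2)
  rw [norm_of_nonneg (by positivity)]
  exact h y hy

lemma Moderate.mul_negligible {R : Type*} [NormedRing R] {e f : ℕ → R} (he : Moderate e)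
    (hf : Negligible f) : Negligible fun y => e y * f y := by
  obtain ⟨p, hp⟩ := he
  obtain ⟨q, hq⟩ := hf
  refine ⟨p + q, (hp.mul hq).congr_right fun y => ?_⟩
  rw [pow_add]; ring

lemma Moderate.mul {R : Type*} [NormedRing R] {e f : ℕ → R} (he : Moderate e)
    (hf : Moderate f) : Moderate fun y => e y * f y := by
  obtain ⟨p, hp⟩ := he
  obtain ⟨q, hq⟩ := hf
  refine ⟨p + q, (hp.mul hq).congr_right fun y => ?_⟩
  rw [pow_add]

lemma Moderate.const (c : E) : Moderate fun _ => c :=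
  Moderate.of_bound (C := ‖c‖) (p := 0) fun y _ => by simp

lemma harm_le_log {n : ℕ} : harm n ≤ 1 + log n := by
  have := harmonic_le_one_add_log n
  rw [harmonic] at this
  push_cast at this
  simpa [harm] using this

lemma logSize_isBigO_log : logSize =O[atTop] fun N : ℕ => log (N : ℝ) := by
  refine IsBigO.of_bound 4 ?_
  filter_upwards [eventually_ge_atTop 3] with N hN
  have hN' : (3 : ℝ) ≤ N := by exact_mod_cast hN
  have hl : 1 ≤ log (N : ℝ) := by
    rw [le_log_iff_exp_le (by linarith)]
    linarith [exp_one_lt_d9]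
  have hL := one_le_logSize N
  rw [norm_of_nonneg (by linarith), norm_of_nonneg (by linarith), logSize]
  have h1 := harm_le_log (n := 2 * N)
  push_cast at h1
  rw [log_mul (by norm_num) (by positivity)] at h1
  have h2 : log 2 ≤ 1 := by linarith [log_two_lt_d9]
  linarith

lemma Negligible.tendsto_zero {e : ℕ → E} (he : Negligible e) : Tendsto e atTop (nhds 0) := by
  obtain ⟨p, hp⟩ := he
  refine hp.trans_tendsto ?_
  have h1 : (fun y : ℕ => logSize (y ^ 2)) =O[atTop] fun y : ℕ => log (y : ℝ) := by
    have h := logSize_isBigO_log.comp_tendsto (tendsto_pow_atTop (α := ℕ) two_ne_zero)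
    simp only [Function.comp_def, Nat.cast_pow, log_pow] at h
    exact h.trans (isBigO_const_mul_self _ _ _)
  have h2 : (fun y : ℕ => log (y : ℝ) ^ p) =o[atTop] fun y : ℕ => (y : ℝ) :=
    (isLittleO_pow_log_id_atTop (n := p)).comp_tendsto tendsto_natCast_atTop_atTop
  exact ((h1.pow p).trans_isLittleO h2).tendsto_div_nhds_zero

end Negligible

section Limit

open Filter Asymptotics

variable {E : Type*} [NormedAddCommGroup E]

lemma Negligible.zero : Negligible fun _ => (0 : E) :=
  Negligible.of_bound (C := 0) (p := 0) fun y _ => by simp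

lemma Negligible.const_mul {R : Type*} [NormedRing R] {e : ℕ → R} (he : Negligible e) (c : R) :
    Negligible fun y => c * e y :=
  (Moderate.const c).mul_negligible he

lemma Negligible.re {e : ℕ → ℂ} (he : Negligible e) : Negligible fun y => (e y).re := by
  obtain ⟨p, hp⟩ := he
  exact ⟨p, (IsBigO.of_bound 1 (Eventually.of_forall fun y => by
    simpa using Complex.abs_re_le_norm (e y))).trans hp⟩

lemma Negligible.sum {ι : Type*} (s : Finset ι) {e : ι → ℕ → E}
    (he : ∀ i ∈ s, Negligible (e i)) : Negligible fun y => ∑ i ∈ s, e i y := by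
  classical
  induction s using Finset.induction_on with
  | empty => simpa using Negligible.zero
  | insert i s hi ih =>
    simp only [Finset.sum_insert hi]
    exact (he i (by simp)).add (ih fun j hj => he j (by simp [hj]))

lemma negligible_nabla_replicate (f : ℕ → List ℕ → ℂ)
    (hf : ∀ w : List ℕ, (∀ i ∈ w, 0 < i) → (∃ b ∈ w, 2 ≤ b) → Negligible fun y => f y w) (d : ℕ) :
    Negligible fun y => nabla (f y) (List.replicate d 1) -
      (d + 1) * f y (List.replicate (d + 1) 1) := by
  simp only [nabla_replicate, add_sub_cancel_left]
  refine Negligible.sum _ fun i _ => hf _ (fun j hj => ?_) ⟨2, by simp, le_rfl⟩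
  simp only [List.mem_append, List.mem_cons, List.mem_replicate] at hj
  omega

lemma moderate_multitangent (k : List ℕ) (hk : ∀ i ∈ k, 0 < i) :
    Moderate fun y : ℕ => multitangent (y ^ 2) (Complex.I * (y : ℝ)) k := by
  refine Moderate.of_bound (C := 2 ^ k.length) (p := k.length) fun y hy => ?_
  rw [← mul_pow]
  exact (norm_multitangent_le (by exact_mod_cast hy) _ k hk).1

lemma negligible_multitangent (k : List ℕ) (hk : ∀ i ∈ k, 0 < i) (h : ∃ b ∈ k, 2 ≤ b) :
    Negligible fun y : ℕ => multitangent (y ^ 2) (Complex.I * (y : ℝ)) k := by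
  refine Negligible.of_bound (C := 2 ^ k.length) (p := k.length + 1) fun y hy => ?_
  refine ((norm_multitangent_le (by exact_mod_cast hy) _ k hk).2 h).trans (le_of_eq ?_)
  rw [mul_pow]
  ring

lemma negligible_multitangent_replicate (d : ℕ) :
    Negligible fun y : ℕ => multitangent (y ^ 2) (Complex.I * (y : ℝ)) (List.replicate d 1) -
      (-(Complex.I * π)) ^ d / (d.factorial : ℂ) := by
  induction d with
  | zero => simpa [multitangent] using Negligible.zero
  | succ d ih =>
    have h1 := negligible_nabla_replicate
      (fun y : ℕ => multitangent (y ^ 2) (Complex.I * (y : ℝ)))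
      (fun w hw h => negligible_multitangent w hw h) d
    simp only [multitangent, nabla_qs] at h1
    have h2 : Negligible fun y : ℕ => ((List.range (2 * y ^ 2 + 1)).map fun i : ℕ =>
        1 / (Complex.I * (y : ℝ) + ((i : ℤ) - (y ^ 2 : ℕ) : ℤ))).sum + Complex.I * π :=
      Negligible.of_bound (C := 5) (p := 0) fun y hy => by
        simpa [div_eq_mul_inv] using multitangent_one_sub_le hy
    have h3 := (moderate_multitangent (List.replicate d 1) (by simp)).mul_negligible h2
    have h4 := ((h1.const_mul (-1)).add (h3.add (ih.const_mul (-(Complex.I * π))))).const_mul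
      (1 / ((d : ℂ) + 1))
    refine (congrArg Negligible (funext fun y => ?_)).mp h4
    have hd : (d : ℂ) + 1 ≠ 0 := by exact_mod_cast d.succ_ne_zero
    have hd' : (d.factorial : ℂ) ≠ 0 := by exact_mod_cast d.factorial_ne_zero
    simp only [multitangent, Nat.factorial_succ]
    push_cast
    field_simp
    ring

lemma deltaVal_eq_ones (w : List ℕ) :
    deltaVal w = ones (fun n => deltaVal (List.replicate n 1)) w := by
  rw [ones]
  split_ifs with h
  · rw [← List.eq_replicate_of_mem h]
  · rw [deltaVal, if_neg]
    simpa using fun h' => absurd h' h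

lemma re_pow_div_factorial (d : ℕ) :
    ((-(Complex.I * π)) ^ d / (d.factorial : ℂ)).re = deltaVal (List.replicate d 1) := by
  have h : ((-(Complex.I * π)) ^ d / (d.factorial : ℂ)) =
      (-Complex.I) ^ d * ((π ^ d / d.factorial : ℝ) : ℂ) := by
    push_cast
    rw [← neg_mul, mul_pow, mul_div_assoc]
  rw [h, Complex.re_mul_ofReal, deltaVal]
  rcases Nat.even_or_odd' d with ⟨n, rfl | rfl⟩
  · rw [pow_mul, neg_sq, Complex.I_sq, if_pos (by simp)]
    have : ((-1 : ℂ) ^ n).re = (-1) ^ n := by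
      have : ((-1 : ℂ) ^ n) = (((-1 : ℝ) ^ n : ℝ) : ℂ) := by push_cast; rfl
      rw [this, Complex.ofReal_re]
    simp [this, mul_div_assoc]
  · rw [pow_succ, pow_mul, neg_sq, Complex.I_sq, if_neg (by simp)]
    have : ((-1 : ℂ) ^ n) = (((-1 : ℝ) ^ n : ℝ) : ℂ) := by push_cast; rfl
    rw [this, Complex.re_ofReal_mul]
    simp

lemma negligible_re_multitangent (k : List ℕ) (hk : ∀ i ∈ k, 0 < i) :
    Negligible fun y : ℕ =>
      (multitangent (y ^ 2) (Complex.I * (y : ℝ)) k).re - deltaVal k := by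
  by_cases h : ∀ i ∈ k, i = 1
  · rw [List.eq_replicate_of_mem h]
    simpa only [Complex.sub_re, re_pow_div_factorial] using
      (negligible_multitangent_replicate k.length).re
  · rw [deltaVal_eq_ones, ones, if_neg h]
    push Not at h
    obtain ⟨b, hb, hb1⟩ := h
    simpa using (negligible_multitangent k hk ⟨b, hb, by have := hk b hb; omega⟩).re

theorem negligible_defect_truncated (k : List ℕ) (hk : ∀ i ∈ k, 0 < i) :
    Negligible fun y : ℕ => defect (truncated (y ^ 2)) (evenZeta (y ^ 2)) k - deltaVal k := by
  rcases eq_or_ne k [] with rfl | hk0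
  · simpa [defect, deltaVal, truncated_nil] using Negligible.zero
  · obtain ⟨C, p, h⟩ := abs_defect_sub_re_le k hk0 hk
    have h1 : Negligible fun y : ℕ => defect (truncated (y ^ 2)) (evenZeta (y ^ 2)) k -
        (multitangent (y ^ 2) (Complex.I * (y : ℝ)) k).re :=
      Negligible.of_bound (C := C) (p := p) fun y hy => by
        simpa [mul_div_assoc] using h y hy
    simpa using h1.add (negligible_re_multitangent k hk)

end Limit

section Regularization

open Filter Asymptotics

/-- The exponential of `t y₁`. -/
noncomputable def expOnes (t : ℝ) : List ℕ → ℝ := ones fun n => t ^ n / (n.factorial : ℝ)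

lemma conv_expOnes_neg (t : ℝ) : conv (expOnes t) (expOnes (-t)) = convOne := by
  rw [expOnes, expOnes, conv_ones]
  have h : ∀ n : ℕ, ∑ ij ∈ Finset.HasAntidiagonal.antidiagonal n,
      t ^ ij.1 / (ij.1.factorial : ℝ) * ((-t) ^ ij.2 / (ij.2.factorial : ℝ)) =
      if n = 0 then 1 else 0 := by
    intro n
    have h1 := (Commute.all t (-t)).add_pow' n
    rw [add_neg_cancel] at h1
    have h2 : ∑ ij ∈ Finset.HasAntidiagonal.antidiagonal n,
        t ^ ij.1 / (ij.1.factorial : ℝ) * ((-t) ^ ij.2 / (ij.2.factorial : ℝ)) =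
        (0 : ℝ) ^ n / (n.factorial : ℝ) := by
      rw [h1, Finset.sum_div]
      refine Finset.sum_congr rfl fun ij hij => ?_
      have hn : ij.1 + ij.2 = n := Finset.HasAntidiagonal.mem_antidiagonal.1 hij
      have h3 : ((n.choose ij.1 : ℕ) : ℝ) * ij.1.factorial * ij.2.factorial = n.factorial := by
        rw [← hn]
        rw [Nat.choose_symm_add]
        exact_mod_cast Nat.add_choose_mul_factorial_mul_factorial ij.1 ij.2
      have h4 : (ij.1.factorial : ℝ) ≠ 0 := by positivity
      have h5 : (ij.2.factorial : ℝ) ≠ 0 := by positivity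
      have h6 : (n.factorial : ℝ) ≠ 0 := by positivity
      rw [nsmul_eq_mul, div_mul_div_comm, div_eq_div_iff (by positivity) h6, ← h3]
      ring
    rw [h2]
    split_ifs with hn
    · simp [hn]
    · simp [hn]
  simp only [h]
  funext w
  cases w with
  | nil => simp [ones, convOne]
  | cons b v => simp [ones, convOne]

/-- The truncated sums, regularized so that the word `[1]` has the value `c`. -/
noncomputable def regularized (N : ℕ) (c : ℝ) : List ℕ → ℝ :=
  conv (truncated N) (expOnes (-(harm N - c)))

lemma defect_conv_expOnes (f : List ℕ → ℝ) (s : ℕ → ℝ) (t : ℝ) (w : List ℕ)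
    (hw : ∀ i ∈ w, 0 < i) :
    defect (conv f (expOnes (-t))) s w =
      conv (expOnes t) (conv (defect f s) (expOnes (-t))) w := by
  rw [expOnes, defect_conv_ones f s _ w hw]
  congr 2
  funext n
  rw [mul_div_assoc', ← mul_pow, neg_one_mul, neg_neg]

lemma defect_conv_expOnes_sub (f : List ℕ → ℝ) (s : ℕ → ℝ) (t : ℝ) (w : List ℕ)
    (hw : ∀ i ∈ w, 0 < i) :
    defect (conv f (expOnes (-t))) s w - deltaVal w =
      conv (expOnes t) (conv (fun u => defect f s u - deltaVal u) (expOnes (-t))) w := by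
  have h1 : conv (expOnes t) (conv deltaVal (expOnes (-t))) = deltaVal := by
    have : deltaVal = ones fun n => deltaVal (List.replicate n 1) := funext deltaVal_eq_ones
    rw [← conv_assoc, this, expOnes, conv_ones_comm, conv_assoc, ← expOnes, conv_expOnes_neg,
      conv_one_right]
  rw [defect_conv_expOnes f s t w hw]
  conv_lhs => rw [← h1]
  simp only [conv_eq_sum, ← Finset.sum_sub_distrib, ← mul_sub, ← sub_mul]

lemma moderate_harm_sub (c : ℝ) : Moderate fun y : ℕ => harm (y ^ 2) - c := by
  refine Moderate.of_bound (C := 1 + |c|) (p := 1) fun y _ => ?_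
  have h1 := harm_le_logSize (show y ^ 2 ≤ 2 * y ^ 2 by omega)
  have h2 := harm_nonneg (y ^ 2)
  have h3 := one_le_logSize (y ^ 2)
  refine (norm_sub_le _ _).trans ?_
  rw [norm_of_nonneg h2, Real.norm_eq_abs]
  nlinarith [abs_nonneg c]

lemma Moderate.pow {e : ℕ → ℝ} (he : Moderate e) (n : ℕ) : Moderate fun y => e y ^ n := by
  induction n with
  | zero => simpa using Moderate.const (1 : ℝ)
  | succ n ih => simpa only [pow_succ] using ih.mul he

lemma Moderate.expOnes {e : ℕ → ℝ} (he : Moderate e) (w : List ℕ) :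
    Moderate fun y => expOnes (e y) w := by
  simp only [_root_.expOnes, ones]
  split_ifs
  · simpa only [div_eq_mul_inv] using (he.pow _).mul (Moderate.const _)
  · exact Moderate.const 0

theorem tendsto_defect_regularized (c : ℝ) (k : List ℕ) (hk : ∀ i ∈ k, 0 < i) :
    Tendsto (fun y : ℕ => defect (regularized (y ^ 2) c) (evenZeta (y ^ 2)) k) atTop
      (nhds (deltaVal k)) := by
  have hm := moderate_harm_sub c
  have hm' : Moderate fun y : ℕ => -(harm (y ^ 2) - c) := by
    simpa using (Moderate.const (-1 : ℝ)).mul hm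
  have h : Negligible fun y : ℕ =>
      defect (regularized (y ^ 2) c) (evenZeta (y ^ 2)) k - deltaVal k := by
    simp only [regularized, defect_conv_expOnes_sub _ _ _ k hk, conv_eq_sum, Finset.mul_sum]
    refine Negligible.sum _ fun i _ => Negligible.sum _ fun j _ => ?_
    refine (hm.expOnes _).mul_negligible ?_
    have h1 := negligible_defect_truncated ((k.drop i).take j) fun x hx =>
      hk x (List.mem_of_mem_drop (List.mem_of_mem_take hx))
    simpa only [mul_comm] using (hm'.expOnes ((k.drop i).drop j)).mul_negligible h1
  simpa using h.tendsto_zero.add_const (deltaVal k)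

lemma nabla_regularized (N : ℕ) (c : ℝ) (v : List ℕ) (hv : ∀ i ∈ v, 0 < i) :
    nabla (regularized N c) v = c * regularized N c v := by
  have h1 : nabla (truncated N) = fun v => harm N * truncated N v := by
    funext v
    rw [truncated, nabla_qs]
    congr 1
  have h2 : conv (truncated N) (nabla (expOnes (-(harm N - c)))) v =
      conv (truncated N) (fun v => -(harm N - c) * expOnes (-(harm N - c)) v) v := by
    simp only [conv_eq_sum]
    refine Finset.sum_congr rfl fun j _ => ?_
    rw [expOnes, nabla_ones _ _ fun i hi => hv i (List.mem_of_mem_drop hi)]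
    congr 1
    simp only [ones]
    split_ifs
    · rw [pow_succ, Nat.factorial_succ]
      push_cast
      field_simp
    · simp
  rw [regularized, nabla_conv, h1, conv_smul_left, h2]
  simp only [conv_eq_sum, mul_left_comm _ (-(harm N - c)), ← Finset.mul_sum]
  ring

end Regularization

section Nabla

open Filter Asymptotics

variable {R : Type*} [CommRing R]

lemma nabla_append_cons (f : List ℕ → R) (u : List ℕ) (b : ℕ) (v : List ℕ) :
    nabla f (u ++ b :: v) = nabla (fun w => f (w ++ b :: v)) u + f (u ++ (1 + b) :: v) +
      nabla (fun w => f (u ++ b :: w)) v := by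
  induction u generalizing f with
  | nil => simp only [List.nil_append, nabla, List.cons_append]; ring
  | cons a u ih =>
    simp only [List.cons_append, nabla, ih]
    ring

lemma pos_of_mem_stuffle_one {u w : List ℕ} (hu : ∀ i ∈ u, 0 < i) (hw : w ∈ stuffle [1] u) :
    ∀ i ∈ w, 0 < i := by
  induction u generalizing w with
  | nil => simp [stuffle] at hw; simp [hw]
  | cons b u ih =>
    have hu' : ∀ i ∈ u, 0 < i := fun i hi => hu i (by simp [hi])
    have hb : 0 < b := hu b (by simp)
    simp only [stuffle, Multiset.mem_add, Multiset.mem_map, Multiset.mem_singleton] at hw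
    rcases hw with (⟨v, rfl, rfl⟩ | ⟨v, hv, rfl⟩) | ⟨v, rfl, rfl⟩
    · simpa [hb] using hu'
    · simpa [hb] using ih hu' hv
    · simpa using hu'

end Nabla

section TrailingOnes

open Filter Asymptotics

variable {f : ℕ → List ℕ → ℝ} {c : ℝ}

lemma tendsto_append_replicate
    (hf : ∀ n v, (∀ i ∈ v, 0 < i) → nabla (f n) v = c * f n v)
    (h0 : ∀ u : List ℕ, (∀ i ∈ u, 0 < i) → ∀ b, 2 ≤ b →
      Tendsto (fun n => f n (u ++ [b])) atTop (nhds 0)) (t : ℕ) :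
    ∀ u : List ℕ, (∀ i ∈ u, 0 < i) → ∀ b, 2 ≤ b →
      Tendsto (fun n => f n (u ++ b :: List.replicate t 1)) atTop (nhds 0) := by
  induction t using Nat.strong_induction_on with
  | _ t ih =>
    rcases t with _ | t
    · simpa using h0
    intro u hu b hb
    have hpos : ∀ i ∈ u ++ b :: List.replicate t 1, 0 < i := by
      simp only [List.mem_append, List.mem_cons, List.mem_replicate]
      rintro i (hi | rfl | ⟨_, rfl⟩)
      exacts [hu i hi, by omega, one_pos]
    have h1 : Tendsto (fun n => nabla (fun w => f n (w ++ b :: List.replicate t 1)) u) atTop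
        (nhds 0) := by
      simp only [nabla_eq]
      have := tendsto_multiset_sum (f := fun w n => f n (w ++ b :: List.replicate t 1))
        (a := fun _ => (0 : ℝ)) (x := atTop) (stuffle [1] u) fun w hw =>
          ih t (by omega) w (pos_of_mem_stuffle_one hu hw) b hb
      simpa using this
    have h2 := ih t (by omega) u hu (1 + b) (by omega)
    have h3 : Tendsto (fun n => ∑ i ∈ Finset.range t,
        f n (u ++ b :: (List.replicate i 1 ++ 2 :: List.replicate (t - 1 - i) 1))) atTop
        (nhds (∑ i ∈ Finset.range t, (0 : ℝ))) := by
      refine tendsto_finsetSum _ fun i hi => ?_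
      have := ih (t - 1 - i) (by omega) (u ++ b :: List.replicate i 1) (by
        simp only [List.mem_append, List.mem_cons, List.mem_replicate]
        rintro i (hi | rfl | ⟨_, rfl⟩)
        exacts [hu i hi, by omega, one_pos]) 2 le_rfl
      simpa using this
    have h4 := (((ih t (by omega) u hu b hb).const_mul c).sub ((h1.add h2).add h3)).const_mul
      (1 / ((t : ℝ) + 1))
    simp only [mul_zero, Finset.sum_const_zero, add_zero, sub_zero] at h4
    refine h4.congr fun n => ?_
    rw [← hf n _ hpos, nabla_append_cons, nabla_replicate]
    have : (t : ℝ) + 1 ≠ 0 := by positivity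
    field_simp
    ring

lemma tendsto_replicate
    (hf : ∀ n v, (∀ i ∈ v, 0 < i) → nabla (f n) v = c * f n v) (h1 : ∀ n, f n [] = 0)
    (h0 : ∀ u : List ℕ, (∀ i ∈ u, 0 < i) → ∀ b, 2 ≤ b →
      Tendsto (fun n => f n (u ++ [b])) atTop (nhds 0)) (t : ℕ) :
    Tendsto (fun n => f n (List.replicate t 1)) atTop (nhds 0) := by
  induction t with
  | zero => simp [h1]
  | succ t ih =>
    have h3 : Tendsto (fun n => ∑ i ∈ Finset.range t,
        f n (List.replicate i 1 ++ 2 :: List.replicate (t - 1 - i) 1)) atTop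
        (nhds (∑ i ∈ Finset.range t, (0 : ℝ))) :=
      tendsto_finsetSum _ fun i _ =>
        tendsto_append_replicate hf h0 (t - 1 - i) (List.replicate i 1) (by simp) 2 le_rfl
    have h4 := ((ih.const_mul c).sub h3).const_mul (1 / ((t : ℝ) + 1))
    simp only [mul_zero, Finset.sum_const_zero, sub_zero] at h4
    refine h4.congr fun n => ?_
    rw [← hf n _ (by simp), nabla_replicate]
    have : (t : ℝ) + 1 ≠ 0 := by positivity
    field_simp
    ring

lemma eq_replicate_or_append (w : List ℕ) (hw : ∀ i ∈ w, 0 < i) :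
    (∃ t, w = List.replicate t 1) ∨
      ∃ u b t, (∀ i ∈ u, 0 < i) ∧ 2 ≤ b ∧ w = u ++ b :: List.replicate t 1 := by
  induction w using List.reverseRecOn with
  | nil => exact Or.inl ⟨0, rfl⟩
  | append_singleton v b ih =>
    have hv : ∀ i ∈ v, 0 < i := fun i hi => hw i (by simp [hi])
    have hb : 0 < b := hw b (by simp)
    rcases (show b = 1 ∨ 2 ≤ b by omega) with rfl | hb2
    · rcases ih hv with ⟨t, rfl⟩ | ⟨u, a, t, hu, ha, rfl⟩
      · exact Or.inl ⟨t + 1, List.replicate_succ'.symm⟩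
      · exact Or.inr ⟨u, a, t + 1, hu, ha, by simp [List.replicate_succ']⟩
    · exact Or.inr ⟨v, b, 0, hv, hb2, by simp⟩

/-- Convergence to zero on admissible words propagates to all words through the relation
satisfied by the stuffle product with `[1]`. -/
lemma tendsto_zero_of_nabla
    (hf : ∀ n v, (∀ i ∈ v, 0 < i) → nabla (f n) v = c * f n v) (h1 : ∀ n, f n [] = 0)
    (h0 : ∀ u : List ℕ, (∀ i ∈ u, 0 < i) → ∀ b, 2 ≤ b →
      Tendsto (fun n => f n (u ++ [b])) atTop (nhds 0)) (w : List ℕ) (hw : ∀ i ∈ w, 0 < i) :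
    Tendsto (fun n => f n w) atTop (nhds 0) := by
  rcases eq_replicate_or_append w hw with ⟨t, rfl⟩ | ⟨u, b, t, hu, hb, rfl⟩
  · exact tendsto_replicate hf h1 h0 t
  · exact tendsto_append_replicate hf h0 t u hu b hb

lemma conv_ones_append (g : List ℕ → ℝ) (p : ℕ → ℝ) (v : List ℕ) {b : ℕ} (hb : b ≠ 1) :
    conv g (ones p) (v ++ [b]) = g (v ++ [b]) * p 0 := by
  induction v generalizing g with
  | nil => simp [conv_cons, ones, hb]
  | cons a v ih =>
    rw [List.cons_append, conv_cons, ih]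
    simp [ones, hb]

lemma regularized_append (N : ℕ) (c : ℝ) (v : List ℕ) {b : ℕ} (hb : b ≠ 1) :
    regularized N c (v ++ [b]) = truncated N (v ++ [b]) := by
  simp [regularized, expOnes, conv_ones_append _ _ _ hb]

lemma regularized_nil (N : ℕ) (c : ℝ) : regularized N c [] = 1 := by
  simp [regularized, expOnes, ones, truncated_nil]

end TrailingOnes

section Tuples

open Filter Asymptotics

/-- Strictly increasing tuples of integers in `(s, N]`. -/
noncomputable def tuples (n s N : ℕ) : Finset (Fin n → ℕ) :=
  open Classical in (Fintype.piFinset fun _ => Finset.Ioc s N).filter fun f => StrictMono f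

lemma mem_tuples {n s N : ℕ} {f : Fin n → ℕ} :
    f ∈ tuples n s N ↔ (∀ i, s < f i ∧ f i ≤ N) ∧ StrictMono f := by
  simp [tuples]

lemma strictMono_cons_iff {n : ℕ} {a : ℕ} {f : Fin n → ℕ} :
    StrictMono (Fin.cons a f : Fin (n + 1) → ℕ) ↔ (∀ i, a < f i) ∧ StrictMono f := by
  constructor
  · intro h
    exact ⟨fun i => by simpa using h (Fin.succ_pos i),
      fun i j hij => by simpa using h (Fin.succ_lt_succ_iff.2 hij)⟩
  · rintro ⟨h1, h2⟩ i j
    refine Fin.cases ?_ (fun i => ?_) i <;> refine Fin.cases ?_ (fun j => ?_) j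
    · simp
    · simpa using h1 j
    · simp
    · simpa using fun hij => h2 hij

lemma sum_tuples_cons {R : Type*} [AddCommMonoid R] (n s N : ℕ) (hs : s < N)
    (g : (Fin (n + 1) → ℕ) → R) :
    ∑ f ∈ tuples (n + 1) s N, g f =
      ∑ f ∈ tuples (n + 1) (s + 1) N, g f +
        ∑ f ∈ tuples n (s + 1) N, g (Fin.cons (s + 1) f) := by
  rw [← Finset.sum_filter_not_add_sum_filter _ fun f => f 0 = s + 1]
  congr 1
  · refine Finset.sum_congr ?_ fun _ _ => rfl
    ext f
    simp only [Finset.mem_filter, mem_tuples]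
    constructor
    · rintro ⟨⟨h1, h2⟩, h3⟩
      refine ⟨fun i => ⟨?_, (h1 i).2⟩, h2⟩
      have := h2.monotone (Fin.zero_le i)
      have := (h1 0).1
      omega
    · rintro ⟨h1, h2⟩
      have := (h1 0).1
      exact ⟨⟨fun i => ⟨by have := (h1 i).1; omega, (h1 i).2⟩, h2⟩, by omega⟩
  · symm
    refine Finset.sum_bij' (fun f _ => Fin.cons (s + 1) f) (fun f _ => Fin.tail f) ?_ ?_ ?_ ?_ ?_
    · intro f hf
      rw [mem_tuples] at hf
      rw [Finset.mem_filter, mem_tuples, strictMono_cons_iff]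
      refine ⟨⟨fun i => ?_, fun i => (hf.1 i).1, hf.2⟩, rfl⟩
      refine Fin.cases ?_ (fun i => ?_) i
      · exact ⟨Nat.lt_succ_self s, hs⟩
      · have := hf.1 i
        simp only [Fin.cons_succ]
        omega
    · intro f hf
      rw [Finset.mem_filter, mem_tuples] at hf
      obtain ⟨⟨h1, h2⟩, h3⟩ := hf
      rw [← Fin.cons_self_tail f, strictMono_cons_iff, h3] at h2
      exact mem_tuples.2 ⟨fun i => ⟨h2.1 i, (h1 i.succ).2⟩, h2.2⟩
    · intro f _
      exact Fin.tail_cons _ _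
    · intro f hf
      rw [← (Finset.mem_filter.1 hf).2]
      exact Fin.cons_self_tail f
    · intro f _
      rfl

lemma tuples_zero (s N : ℕ) : tuples 0 s N = {fun i => i.elim0} := by
  ext f
  rw [mem_tuples, Finset.mem_singleton]
  exact ⟨fun _ => funext fun i => i.elim0, fun _ => ⟨fun i => i.elim0, fun i => i.elim0⟩⟩

lemma tuples_succ_self (n s : ℕ) : tuples (n + 1) s s = ∅ := by
  refine Finset.eq_empty_of_forall_notMem fun f hf => ?_
  have := (mem_tuples.1 hf).1 0
  omega

lemma sum_tuples {R : Type*} [CommRing R] (x : ℕ → R) (n s : ℕ) (k : List ℕ) :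
    ∑ f ∈ tuples k.length s (s + n), ∏ i, x (f i) ^ k.get i =
      qs ((List.range' (s + 1) n).map x) k := by
  induction n generalizing s k with
  | zero =>
    cases k with
    | nil => simp [tuples_zero]
    | cons b v => simp [tuples_succ_self, qs, convOne]
  | succ n ih =>
    cases k with
    | nil => simp [tuples_zero]
    | cons b v =>
      rw [List.range'_succ, List.map_cons, qs_cons_cons, ← ih, ← ih,
        show s + (n + 1) = s + 1 + n by ring]
      have := sum_tuples_cons v.length s (s + 1 + n) (by omega)
        fun f => ∏ i, x (f i) ^ (b :: v).get i
      simp only [List.length_cons] at this ⊢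
      rw [this, Finset.mul_sum]
      congr 1
      refine Finset.sum_congr rfl fun f _ => ?_
      rw [Fin.prod_univ_succ]
      rfl

lemma truncated_eq_sum (N : ℕ) (k : List ℕ) :
    truncated N k = ∑ f ∈ tuples k.length 0 N, ∏ i, (1 / (f i : ℝ)) ^ k.get i := by
  have h := sum_tuples (fun m => 1 / (m : ℝ)) N 0 k
  rw [Nat.zero_add] at h
  rw [h, truncated, Nat.zero_add, List.range'_eq_map_range, List.map_map]
  congr 2
  funext i
  simp [add_comm]

/-- The natural number tuple underlying a strictly increasing tuple of positive integers. -/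
def tupleVal {n : ℕ} (m : {f : Fin n → ℕ+ // StrictMono f}) : Fin n → ℕ := fun i => m.1 i

lemma tupleVal_injective {n : ℕ} :
    Function.Injective (tupleVal : {f : Fin n → ℕ+ // StrictMono f} → Fin n → ℕ) :=
  fun _ _ h => Subtype.ext (funext fun i => PNat.coe_injective (congrFun h i))

/-- Strictly increasing tuples of positive integers bounded by `N`. -/
noncomputable def pnatTuples (n N : ℕ) : Finset {f : Fin n → ℕ+ // StrictMono f} :=
  (tuples n 0 N).preimage tupleVal tupleVal_injective.injOn

lemma mem_pnatTuples {n N : ℕ} {m : {f : Fin n → ℕ+ // StrictMono f}} :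
    m ∈ pnatTuples n N ↔ ∀ i, (m.1 i : ℕ) ≤ N := by
  rw [pnatTuples, Finset.mem_preimage, mem_tuples]
  exact ⟨fun h i => (h.1 i).2, fun h => ⟨fun i => ⟨(m.1 i).pos, h i⟩, fun i j hij => m.2 hij⟩⟩

lemma sum_pnatTuples (N : ℕ) (k : List ℕ) :
    ∑ m ∈ pnatTuples k.length N, ∏ i, 1 / ((m.1 i : ℕ) : ℝ) ^ k.get i = truncated N k := by
  rw [truncated_eq_sum, pnatTuples]
  simp only [one_div_pow]
  refine Finset.sum_preimage tupleVal (tuples k.length 0 N) tupleVal_injective.injOn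
    (fun f => ∏ i, 1 / ((f i : ℕ) : ℝ) ^ k.get i) fun f hf hf' => ?_
  refine absurd ⟨⟨fun i => ⟨f i, ((mem_tuples.1 hf).1 i).1⟩, fun i j hij => ?_⟩, rfl⟩ hf'
  exact (mem_tuples.1 hf).2 hij

lemma tendsto_pnatTuples (n : ℕ) : Tendsto (pnatTuples n) atTop atTop := by
  refine tendsto_atTop_finset_of_monotone (fun N N' h m hm => ?_) fun m => ?_
  · rw [mem_pnatTuples] at hm ⊢
    exact fun i => (hm i).trans h
  · exact ⟨∑ i, (m.1 i : ℕ), mem_pnatTuples.2 fun i =>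
      Finset.single_le_sum (f := fun i => (m.1 i : ℕ)) (fun _ _ => Nat.zero_le _)
        (Finset.mem_univ i)⟩

lemma tendsto_truncated_of_le (k : List ℕ) {C : ℝ} (h : ∀ N, truncated N k ≤ C) :
    Tendsto (fun N => truncated N k) atTop (nhds (MZV k)) := by
  have hs : Summable fun m : {f : Fin k.length → ℕ+ // StrictMono f} =>
      ∏ i, 1 / ((m.1 i : ℕ) : ℝ) ^ k.get i := by
    have hnn : ∀ m : {f : Fin k.length → ℕ+ // StrictMono f},
        0 ≤ ∏ i, 1 / ((m.1 i : ℕ) : ℝ) ^ k.get i :=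
      fun m => Finset.prod_nonneg fun _ _ => by positivity
    refine summable_of_sum_le hnn (c := C) fun u => ?_
    obtain ⟨N, hN⟩ := (tendsto_pnatTuples k.length).eventually_ge_atTop u |>.exists
    exact (Finset.sum_le_sum_of_subset_of_nonneg hN fun m _ _ => hnn m).trans
      ((sum_pnatTuples N k).trans_le (h N))
  simpa only [sum_pnatTuples, Function.comp_def, MZV] using
    hs.hasSum.comp (tendsto_pnatTuples k.length)

end Tuples

section Convergence

open Filter Asymptotics

lemma bddAbove_truncated_append (v : List ℕ) (hv : ∀ i ∈ v, 0 < i) {b : ℕ} (hb : 2 ≤ b) :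
    ∃ C, ∀ N, truncated N (v ++ [b]) ≤ C := by
  obtain ⟨C, p, -, h⟩ := truncated_bounds v hv
  have h1 : (fun M : ℕ => truncated M v) =O[atTop] fun M : ℕ => (M : ℝ) ^ (1 / 2 : ℝ) := by
    have h2 : (fun M : ℕ => truncated M v) =O[atTop] fun M : ℕ => logSize M ^ p := by
      refine IsBigO.of_bound C (Eventually.of_forall fun M => ?_)
      have hL := one_le_logSize M
      rw [norm_of_nonneg (show 0 ≤ logSize M ^ p by positivity)]
      exact (h M M (by omega)).1
    have h3 : (fun M : ℕ => log (M : ℝ) ^ p) =o[atTop] fun M : ℕ => (M : ℝ) ^ (1 / 2 : ℝ) := by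
      simpa only [rpow_natCast, Function.comp_def] using
        (isLittleO_log_rpow_rpow_atTop (p : ℝ) (show (0 : ℝ) < 1 / 2 by norm_num)).comp_tendsto
          tendsto_natCast_atTop_atTop
    exact (h2.trans (logSize_isBigO_log.pow p)).trans h3.isBigO
  have h2 : (fun M : ℕ => (1 / ((M : ℝ) + 1)) ^ b) =O[atTop] fun M : ℕ => (M : ℝ) ^ (-2 : ℝ) := by
    refine IsBigO.of_bound 1 ?_
    filter_upwards [eventually_ge_atTop 1] with M hM
    have hM' : (1 : ℝ) ≤ M := by exact_mod_cast hM
    rw [one_mul, norm_of_nonneg (by positivity), norm_of_nonneg (by positivity),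
      rpow_neg (by positivity), rpow_two]
    calc (1 / ((M : ℝ) + 1)) ^ b ≤ (1 / ((M : ℝ) + 1)) ^ 2 :=
          pow_le_pow_of_le_one (by positivity) (by rw [div_le_one (by positivity)]; linarith) hb
      _ ≤ ((M : ℝ) ^ 2)⁻¹ := by
          rw [one_div, inv_pow]
          gcongr
          linarith
  have h3 : Summable fun M : ℕ => truncated M v * (1 / ((M : ℝ) + 1)) ^ b := by
    refine summable_of_isBigO_nat
      (summable_nat_rpow.2 (show (-(3 / 2) : ℝ) < -1 by norm_num)) ((h1.mul h2).trans ?_)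
    refine IsBigO.of_bound 1 ?_
    filter_upwards [eventually_ge_atTop 1] with M hM
    have hM' : (0 : ℝ) < M := by exact_mod_cast hM
    rw [← rpow_add hM', one_mul]
    norm_num
  refine ⟨∑' M : ℕ, truncated M v * (1 / ((M : ℝ) + 1)) ^ b, fun N => ?_⟩
  have h4 : truncated N (v ++ [b]) =
      ∑ M ∈ Finset.range N, truncated M v * (1 / ((M : ℝ) + 1)) ^ b := by
    induction N with
    | zero => simp [truncated_zero]
    | succ N ih => rw [truncated_succ, ih, Finset.sum_range_succ]
  rw [h4]
  exact h3.sum_le_tsum _ fun M _ => mul_nonneg (truncated_nonneg M v) (by positivity)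

lemma tendsto_truncated_append (v : List ℕ) (hv : ∀ i ∈ v, 0 < i) {b : ℕ} (hb : 2 ≤ b) :
    Tendsto (fun N => truncated N (v ++ [b])) atTop (nhds (MZV (v ++ [b]))) :=
  let ⟨_, h⟩ := bddAbove_truncated_append v hv hb
  tendsto_truncated_of_le _ h

lemma tendsto_evenZeta {m : ℕ} (hm : 1 ≤ m) :
    Tendsto (fun N => evenZeta N m) atTop
      (nhds (2 * ∑' n : ℕ+, 1 / ((n : ℕ) : ℝ) ^ (2 * m))) := by
  have h : Summable fun n : ℕ => 1 / ((n : ℝ) + 1) ^ (2 * m) := by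
    have := (summable_nat_add_iff 1).2
      (summable_one_div_nat_pow.2 (show 1 < 2 * m by omega))
    simpa using this
  rw [tsum_pnat_eq_tsum_succ (f := fun n : ℕ => 1 / (n : ℝ) ^ (2 * m))]
  push_cast
  exact h.hasSum.tendsto_sum_nat.const_mul 2

variable {Z : List ℕ → ℝ}

lemma IsStuffleReg.tendsto_regularized (hZ : IsStuffleReg Z) (w : List ℕ) (hw : ∀ i ∈ w, 0 < i) :
    Tendsto (fun N => regularized N (Z [1]) w) atTop (nhds (Z w)) := by
  have hnabla : ∀ v, (∀ i ∈ v, 0 < i) → nabla Z v = Z [1] * Z v := fun v hv => by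
    rw [nabla_eq, hZ.mul [1] v (by simp) hv]
  have h := tendsto_zero_of_nabla (f := fun N w => regularized N (Z [1]) w + -1 * Z w)
    (c := Z [1]) (fun N v hv => by
      rw [nabla_add, nabla_smul, hnabla v hv]
      rw [nabla_regularized N (Z [1]) v hv]
      ring)
    (fun N => by simp [regularized_nil, hZ.empty])
    (fun u hu b hb => by
      have h1 := (tendsto_truncated_append u hu hb).add_const (-1 * Z (u ++ [b]))
      rw [hZ.conv (u ++ [b]) (by simpa [or_imp, forall_and] using ⟨hu, by omega⟩)
        (by simpa using hb)] at h1 ⊢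
      rw [neg_one_mul, add_neg_cancel] at h1
      simpa only [regularized_append _ _ _ (show b ≠ 1 by omega), neg_one_mul] using h1)
    w hw
  simpa using h.add_const (Z w)

variable {ι : Type*} {l : Filter ι} {F : ι → List ℕ → ℝ}

lemma tendsto_zetaA (h : ∀ w : List ℕ, (∀ i ∈ w, 0 < i) → Tendsto (fun n => F n w) l (nhds (Z w)))
    (a : ℕ) (w : List ℕ) (hw : ∀ i ∈ w, 0 < i) :
    Tendsto (fun n => zetaA (F n) a w) l (nhds (zetaA Z a w)) := by
  refine (tendsto_finsetSum _ fun f _ => (h _ fun i hi => ?_).mul_const _).const_mul _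
  obtain ⟨j, rfl⟩ := (List.mem_ofFn' _ _).1 hi
  exact Nat.add_pos_left (hw _ (List.get_mem w j)) _

lemma tendsto_defect (h : ∀ w : List ℕ, (∀ i ∈ w, 0 < i) → Tendsto (fun n => F n w) l (nhds (Z w)))
    {s : ι → ℕ → ℝ} {t : ℕ → ℝ} (hs : ∀ m, 1 ≤ m → Tendsto (fun n => s n m) l (nhds (t m)))
    (k : List ℕ) (hk : ∀ i ∈ k, 0 < i) :
    Tendsto (fun n => defect (F n) (s n) k) l (nhds (defect Z t k)) := by
  have ht : ∀ j, ∀ i ∈ (k.take j).reverse, 0 < i := fun j i hi =>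
    hk i (List.mem_of_mem_take (List.mem_reverse.1 hi))
  have hd : ∀ j, ∀ i ∈ k.drop j, 0 < i := fun j i hi => hk i (List.mem_of_mem_drop hi)
  refine ((tendsto_finsetSum _ fun j _ => ?_).add
    (tendsto_finsetSum _ fun j _ => tendsto_finsetSum _ fun a _ => ?_)).sub
    (tendsto_finsetSum _ fun j _ => tendsto_finsetSum _ fun m hm =>
      tendsto_finsetSum _ fun a _ => ?_)
  · exact ((h _ (ht j)).const_mul _).mul (h _ (hd j))
  · exact ((tendsto_zetaA h _ _ (ht j)).const_mul _).mul (tendsto_zetaA h _ _ (hd _))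
  · exact (((tendsto_zetaA h _ _ (ht j)).const_mul _).mul (tendsto_zetaA h _ _ (hd _))).mul
      (hs m (Finset.mem_Icc.1 hm).1)

theorem IsStuffleReg.defect_eq (hZ : IsStuffleReg Z) (k : List ℕ) (hk : ∀ i ∈ k, 0 < i) :
    defect Z (fun m => 2 * ∑' n : ℕ+, 1 / ((n : ℕ) : ℝ) ^ (2 * m)) k = deltaVal k := by
  have hsq : Tendsto (fun y : ℕ => y ^ 2) atTop atTop := tendsto_pow_atTop two_ne_zero
  refine tendsto_nhds_unique (tendsto_defect (fun w hw => (hZ.tendsto_regularized w hw).comp hsq)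
    (fun m hm => (tendsto_evenZeta hm).comp hsq) k hk) ?_
  exact tendsto_defect_regularized (Z [1]) k hk

end Convergence
/-- Constant-term identity (coefficient of `z⁰` in Bouillot's monotangent reduction):
`∑_{j=0}^d (-1)^{k₁+⋯+k_j} ζ^*(k_j,…,k₁) ζ^*(k_{j+1},…,k_d)
  + ∑_{j=1}^d ∑_{a+b=k_j} (-1)^{k₁+⋯+k_{j-1}+a} ζ_a^*(k_{j-1},…,k₁) ζ_b^*(k_{j+1},…,k_d)
= δ^{k₁,…,k_d}
  + ∑_{j=1}^d ∑_{a+2m+b=k_j, m≥1} (-1)^{k₁+⋯+k_{j-1}+a} ζ_a^*(k_{j-1},…,k₁) ζ_b^*(k_{j+1},…,k_d)·2ζ(2m)`.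
(Below `j ∈ Finset.range k.length` plays the role of the paper's `j - 1`.) -/
theorem constant_term_identity (Z : List ℕ → ℝ) (hZ : IsStuffleReg Z)
    (k : List ℕ) (hk : ∀ i ∈ k, 0 < i) :
    (∑ j ∈ Finset.range (k.length + 1),
        (-1 : ℝ) ^ (k.take j).sum * Z ((k.take j).reverse) * Z (k.drop j)) +
      ∑ j ∈ Finset.range k.length, ∑ a ∈ Finset.range (k.getD j 0 + 1),
        (-1 : ℝ) ^ ((k.take j).sum + a) * zetaA Z a ((k.take j).reverse) *
          zetaA Z (k.getD j 0 - a) (k.drop (j + 1)) =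
    deltaVal k +
      ∑ j ∈ Finset.range k.length, ∑ m ∈ Finset.Icc 1 (k.getD j 0 / 2),
        ∑ a ∈ Finset.range (k.getD j 0 - 2 * m + 1),
          (-1 : ℝ) ^ ((k.take j).sum + a) * zetaA Z a ((k.take j).reverse) *
            zetaA Z (k.getD j 0 - 2 * m - a) (k.drop (j + 1)) *
            (2 * ∑' n : ℕ+, 1 / ((n : ℕ) : ℝ) ^ (2 * m)) := by
  have h := hZ.defect_eq k hk
  rw [defect, sub_eq_iff_eq_add] at h
  exact h
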